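/- arXiv:2306.02237 — 12 statements merged into one kernel-verified Lean document; each statement's English description precedes it below -/
import Mathlib

section
/- Let u = (u₁, …, u_g) ∈ (𝕊¹)^g, let H be the topological closure of the subgroup of (𝕊¹)^g generated by u, and let U be the subgroup of 𝕊¹ generated by {u₁, …, u_g}. Suppose U is isomorphic as an abstract group to ℤ^δ × ℤ/mℤ for natural numbers δ and m ≥ 1. Then H is isomorphic as a topological group to (𝕊¹)^δ × ℤ/mℤ, where ℤ/mℤ carries the discrete topology. (This is the structure theorem for the Serre–Frobenius group: SF(A) ≅ U(1)^δ × C_m, where δ is the angle rank and m the angle torsion order.) -/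
/-- Discrete topology on `ZMod m` (the component group carries the discrete topology). -/
instance zmodTopology (m : ℕ) : TopologicalSpace (ZMod m) := ⊥

open MeasureTheory in
/-- In a compact abelian group, a point outside a closed subgroup is separated from it by a
character taken from any given point-separating group of characters. -/
theorem Subgroup.exists_character_separating {G : Type*} [CommGroup G] [TopologicalSpace G]
    [IsTopologicalGroup G] [CompactSpace G] [T2Space G] (X : Subgroup (G →ₜ* Circle))
    (hX : ∀ x y : G, x ≠ y → ∃ χ ∈ X, χ x ≠ χ y) {K : Subgroup G} (hK : IsClosed (K : Set G))
    {x : G} (hx : x ∉ K) : ∃ χ ∈ X, (∀ k ∈ K, χ k = 1) ∧ χ x ≠ 1 := by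
  by_contra! h
  have : CompactSpace K := isCompact_iff_compactSpace.mp hK.isCompact
  let _ : MeasurableSpace K := borel K
  have : BorelSpace K := ⟨rfl⟩
  let μ : Measure K := Measure.haar
  have integrable (f : C(K, ℂ)) : Integrable f μ :=
    f.continuous.integrable_of_hasCompactSupport (HasCompactSupport.of_compactSpace f)
  let I : C(K, ℂ) →L[ℂ] ℂ := LinearMap.mkContinuous
    { toFun := fun f => ∫ k, f k ∂μ
      map_add' := fun f₁ f₂ => integral_add (integrable f₁) (integrable f₂)
      map_smul' := fun c f => integral_const_mul c f } (μ.real Set.univ) fun f => by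
        rw [mul_comm]
        exact norm_integral_le_of_norm_le_const (.of_forall f.norm_coe_le_norm)
  let i₁ : C(K, G) := ⟨fun k => k, by fun_prop⟩
  let i₂ : C(K, G) := ⟨fun k => x * k, by fun_prop⟩
  let toFn : (G →ₜ* Circle) →* C(G, ℂ) :=
    { toFun := fun χ => ⟨fun y => χ y, by fun_prop⟩
      map_one' := by ext; simp
      map_mul' := fun _ _ => by ext; simp }
  have agree_on_characters (χ : G →ₜ* Circle) (hχ : χ ∈ X) :
      I ((toFn χ).comp i₁) = I ((toFn χ).comp i₂) := by
    change ∫ k : K, ((χ k : Circle) : ℂ) ∂μ = ∫ k : K, ((χ (x * k) : Circle) : ℂ) ∂μ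
    simp_rw [map_mul, Circle.coe_mul, integral_const_mul]
    by_cases hχK : ∀ k ∈ K, χ k = 1
    · simp [h χ hχ hχK]
    · push Not at hχK
      obtain ⟨k₀, hk₀, hne⟩ := hχK
      have key := integral_mul_left_eq_self (μ := μ) (fun k : K => ((χ k : Circle) : ℂ)) ⟨k₀, hk₀⟩
      simp only [Subgroup.coe_mul, map_mul, Circle.coe_mul, integral_const_mul] at key
      have : ∫ k : K, ((χ k : Circle) : ℂ) ∂μ = 0 := by
        by_contra h0
        exact hne (Circle.coe_eq_one.mp (mul_right_cancel₀ h0 (key.trans (one_mul _).symm)))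
      simp [this]
  let S : Set C(G, ℂ) := X.toSubmonoid.map toFn
  have star_S : star S ⊆ S := by
    rintro f ⟨χ, hχ, hf⟩
    refine ⟨χ⁻¹, X.inv_mem hχ, ?_⟩
    rw [← star_star f, ← hf]
    ext y
    exact Circle.coe_inv_eq_conj _
  have dense : (StarAlgebra.adjoin ℂ S).topologicalClosure = ⊤ := by
    refine ContinuousMap.starSubalgebra_topologicalClosure_eq_top_of_separatesPoints _ ?_
    intro y z hyz
    obtain ⟨χ, hχ, hne⟩ := hX y z hyz
    exact ⟨_, ⟨toFn χ, StarAlgebra.subset_adjoin ℂ S ⟨χ, hχ, rfl⟩, rfl⟩,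
      fun heq => hne (Circle.ext heq)⟩
  have agree (f : C(G, ℂ)) : I (f.comp i₁) = I (f.comp i₂) := by
    have hf : f ∈ (StarAlgebra.adjoin ℂ S).topologicalClosure := dense ▸ StarSubalgebra.mem_top
    refine closure_minimal (t := {f : C(G, ℂ) | I (f.comp i₁) = I (f.comp i₂)}) ?_
      (isClosed_eq (by fun_prop) (by fun_prop)) hf
    intro p hp
    have span_eq := StarAlgebra.adjoin_eq_span (R := ℂ) S
    rw [Set.union_eq_self_of_subset_right star_S, Submonoid.closure_eq] at span_eq
    have hp : p ∈ Submodule.span ℂ S := span_eq ▸ hp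
    refine Submodule.span_induction (p := fun p _ => I (p.comp i₁) = I (p.comp i₂))
      ?_ rfl ?_ ?_ hp
    · rintro _ ⟨χ, hχ, rfl⟩
      exact agree_on_characters χ hχ
    · intro p q _ _ hp hq
      exact (map_add I _ _).trans ((congrArg₂ (· + ·) hp hq).trans (map_add I _ _).symm)
    · intro c p _ hp
      exact (map_smul I c _).trans ((congrArg (c • ·) hp).trans (map_smul I c _).symm)
  have coset_closed : IsClosed ((x * ·) '' (K : Set G)) :=
    (Homeomorph.mulLeft x).isClosedMap _ hK
  have disjoint : Disjoint (K : Set G) ((x * ·) '' (K : Set G)) := by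
    rw [Set.disjoint_left]
    rintro _ hk ⟨l, hl, rfl⟩
    exact hx ((K.mul_mem_cancel_right hl).mp hk)
  obtain ⟨f, hf₀, hf₁, -⟩ := exists_continuous_zero_one_of_isClosed hK coset_closed disjoint
  have := agree ⟨fun y => (f y : ℂ), by fun_prop⟩
  change ∫ k : K, ((f k : ℝ) : ℂ) ∂μ = ∫ k : K, ((f (x * k) : ℝ) : ℂ) ∂μ at this
  have e₀ (k : K) : f k = 0 := hf₀ k.2
  have e₁ (k : K) : f (x * k) = 1 := hf₁ ⟨k, k.2, rfl⟩
  simp [e₀, e₁, Measure.real] at this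
  have mass_pos := ENNReal.toReal_pos (Measure.measure_univ_ne_zero.mpr (NeZero.ne μ))
    (measure_ne_top μ Set.univ)
  exact mass_pos.ne (by exact_mod_cast this)

/-- Applying a homomorphism to the circle, defined on a group containing all the `u i`, to the
coordinates of `u` gives a point of the closure of the subgroup of the torus generated by `u`. -/
theorem evaluation_mem_topologicalClosure {ι : Type*} (u : ι → Circle)
    (U : Subgroup Circle) (hu : ∀ i, u i ∈ U) (φ : U →* Circle) :
    (fun i => φ ⟨u i, hu i⟩) ∈ (Subgroup.closure {u}).topologicalClosure := by
  by_contra hx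
  let proj (i : ι) : (ι → Circle) →ₜ* Circle := ⟨Pi.evalMonoidHom _ i, continuous_apply i⟩
  have hsep (x y : ι → Circle) (hxy : x ≠ y) :
      ∃ χ ∈ Subgroup.closure (Set.range proj), χ x ≠ χ y := by
    obtain ⟨i, hi⟩ := Function.ne_iff.mp hxy
    exact ⟨proj i, Subgroup.subset_closure ⟨i, rfl⟩, hi⟩
  obtain ⟨χ, hχ, hχK, hne⟩ := Subgroup.exists_character_separating _ hsep
    (Subgroup.isClosed_topologicalClosure _) hx
  have naturality : ∃ w : U, χ u = w ∧ χ (fun i => φ ⟨u i, hu i⟩) = φ w := by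
    clear hχK hne
    induction hχ using Subgroup.closure_induction with
    | mem χ hχ => obtain ⟨i, rfl⟩ := hχ; exact ⟨⟨u i, hu i⟩, rfl, rfl⟩
    | one => exact ⟨1, rfl, (map_one φ).symm⟩
    | mul χ ψ _ _ hχ hψ =>
      obtain ⟨w, h₁, h₂⟩ := hχ
      obtain ⟨v, h₃, h₄⟩ := hψ
      exact ⟨w * v, by simp [h₁, h₃], by simp [h₂, h₄]⟩
    | inv χ _ hχ =>
      obtain ⟨w, h₁, h₂⟩ := hχ
      exact ⟨w⁻¹, by simp [← h₁]; rfl, by simp [← h₂]; rfl⟩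
  obtain ⟨w, h₁, h₂⟩ := naturality
  have hw : w = 1 := Subtype.ext (h₁.symm.trans
    (hχK u (Subgroup.le_topologicalClosure _ (Subgroup.subset_closure rfl))))
  exact hne (by rw [h₂, hw, map_one])

/-- The homomorphism `ℤ^δ × ℤ/mℤ → 𝕊¹` attached to a point of `(𝕊¹)^δ × ℤ/mℤ`. -/
noncomputable def torusChar {δ m : ℕ} [NeZero m] :
    (Fin δ → Circle) × Multiplicative (ZMod m) →*
      Multiplicative ((Fin δ → ℤ) × ZMod m) →* Circle where
  toFun t :=
    { toFun := fun x => (∏ j, t.1 j ^ x.toAdd.1 j) * AddChar.zmod m t.2.toAdd x.toAdd.2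
      map_one' := by simp
      map_mul' := fun x y => by
        simp [zpow_add, Finset.prod_mul_distrib, AddChar.map_add_eq_mul, mul_mul_mul_comm] }
  map_one' := by ext; simp
  map_mul' s t := by
    ext
    simp [mul_zpow, Finset.prod_mul_distrib, mul_mul_mul_comm]

theorem torusChar_apply {δ m : ℕ} [NeZero m] (t : (Fin δ → Circle) × Multiplicative (ZMod m))
    (x : Multiplicative ((Fin δ → ℤ) × ZMod m)) :
    torusChar t x = (∏ j, t.1 j ^ x.toAdd.1 j) * AddChar.zmod m t.2.toAdd x.toAdd.2 := rfl

theorem torusChar_injective {δ m : ℕ} [NeZero m] :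
    Function.Injective (torusChar (δ := δ) (m := m)) := by
  rintro ⟨s, a⟩ ⟨t, b⟩ h
  refine Prod.ext (funext fun j => ?_) (AddChar.zmod_injective (DFunLike.ext _ _ fun y => ?_))
  · simpa [torusChar_apply, Pi.single_apply] using
      DFunLike.congr_fun h (Multiplicative.ofAdd (Pi.single j 1, 0))
  · have key := DFunLike.congr_fun h (Multiplicative.ofAdd (0, y))
    simp only [torusChar_apply, toAdd_ofAdd, Pi.zero_apply, zpow_zero, Finset.prod_const_one,
      one_mul] at key
    exact key

theorem torusChar_surjective {δ m : ℕ} [NeZero m] :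
    Function.Surjective (torusChar (δ := δ) (m := m)) := by
  intro ψ
  let ψ' : AddChar (ZMod m) Circle := AddChar.toMonoidHomEquiv.symm
    (ψ.comp (AddMonoidHom.inr (Fin δ → ℤ) (ZMod m)).toMultiplicative)
  obtain ⟨a, ha⟩ := AddChar.zmodAddEquiv.surjective (AddChar.circleEquivComplex ψ')
  have ha : AddChar.zmod m a = ψ' := AddChar.circleEquivComplex.injective ha
  refine ⟨(fun j => ψ (.ofAdd (Pi.single j 1, 0)), .ofAdd a), MonoidHom.ext fun x => ?_⟩
  rw [torusChar_apply, toAdd_ofAdd, ha]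
  simp_rw [← map_zpow, ← map_prod]
  change ψ _ * ψ (.ofAdd (0, x.toAdd.2)) = _
  rw [← map_mul]
  congr 1
  apply Multiplicative.toAdd.injective
  ext j
  · simp [Prod.fst_sum, Finset.sum_apply, Pi.single_apply]
  · simp [Prod.snd_sum]

theorem continuous_torusChar_apply {δ m : ℕ} [NeZero m]
    (x : Multiplicative ((Fin δ → ℤ) × ZMod m)) :
    Continuous fun t : (Fin δ → Circle) × Multiplicative (ZMod m) => torusChar t x := by
  have : DiscreteTopology (Multiplicative (ZMod m)) := ⟨rfl⟩
  simp_rw [torusChar_apply]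
  have : Continuous fun s : Multiplicative (ZMod m) => AddChar.zmod m s.toAdd x.toAdd.2 :=
    continuous_of_discreteTopology
  exact (by fun_prop : Continuous fun t : (Fin δ → Circle) × Multiplicative (ZMod m) =>
    ∏ j, t.1 j ^ x.toAdd.1 j).mul (this.comp continuous_snd)

/-- **Structure theorem for the Serre–Frobenius group.**
If the subgroup `U` of the circle generated by `u₁, …, u_g` is isomorphic as an abstract
group to `ℤ^δ × ℤ/mℤ`, then the closure `H` of the subgroup of `(𝕊¹)^g` generated by
`u = (u₁, …, u_g)` is isomorphic as a topological group to `(𝕊¹)^δ × ℤ/mℤ`. -/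
theorem serre_frobenius_structure (g δ m : ℕ) (hm : 1 ≤ m) (u : Fin g → Circle)
    (U : Subgroup Circle) (hU : U = Subgroup.closure (Set.range u))
    (H : Subgroup (Fin g → Circle))
    (hH : H = (Subgroup.closure {u}).topologicalClosure)
    (iso : U ≃* Multiplicative ((Fin δ → ℤ) × ZMod m)) :
    ∃ e : H ≃ₜ ((Fin δ → Circle) × Multiplicative (ZMod m)),
      ∀ x y : H, e (x * y) = e x * e y := by
  subst hU hH
  have : NeZero m := ⟨by omega⟩
  have : DiscreteTopology (Multiplicative (ZMod m)) := ⟨rfl⟩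
  have : Finite (Multiplicative (ZMod m)) := inferInstanceAs (Finite (ZMod m))
  have hu (i : Fin g) : u i ∈ Subgroup.closure (Set.range u) := Subgroup.subset_closure ⟨i, rfl⟩
  let ev : (Fin δ → Circle) × Multiplicative (ZMod m) →* (Fin g → Circle) :=
    { toFun := fun t i => torusChar t (iso ⟨u i, hu i⟩)
      map_one' := by ext; simp
      map_mul' := fun _ _ => by ext; simp }
  have ev_continuous : Continuous ev := continuous_pi fun i => continuous_torusChar_apply _
  have ev_injective : Function.Injective ev := by
    intro s t hst
    have hcomp : (torusChar s).comp iso.toMonoidHom = (torusChar t).comp iso.toMonoidHom := by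
      refine MonoidHom.eq_of_eqOn_dense Subgroup.closure_closure_coe_preimage ?_
      rintro ⟨_, _⟩ ⟨i, rfl⟩
      exact congrFun hst i
    refine torusChar_injective (MonoidHom.ext fun x => ?_)
    simpa using DFunLike.congr_fun hcomp (iso.symm x)
  have range_ev : ev.range = (Subgroup.closure {u}).topologicalClosure := by
    refine le_antisymm ?_ (Subgroup.topologicalClosure_minimal _ ?_ ?_)
    · rintro _ ⟨t, rfl⟩
      exact evaluation_mem_topologicalClosure u _ hu ((torusChar t).comp iso.toMonoidHom)
    · rw [Subgroup.closure_le, Set.singleton_subset_iff]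
      obtain ⟨t, ht⟩ := torusChar_surjective
        ((Subgroup.closure (Set.range u)).subtype.comp iso.symm.toMonoidHom)
      exact ⟨t, funext fun i => by simp [ev, ht]⟩
    · exact (isCompact_range ev_continuous).isClosed
  rw [← range_ev]
  have range_continuous : Continuous (MonoidHom.ofInjective ev_injective) :=
    ev_continuous.subtype_mk _
  exact ⟨(range_continuous.homeoOfEquivCompactToT2
    (f := (MonoidHom.ofInjective ev_injective).toEquiv)).symm,
    map_mul (MonoidHom.ofInjective ev_injective).symm⟩
end

section
/- Let u = (u₁, …, u_g) ∈ (𝕊¹)^g, let H be the topological closure of the subgroup of (𝕊¹)^g generated by u, and let U be the subgroup of 𝕊¹ generated by {u₁, …, u_g}. Let m ≥ 1 be the order of the torsion subgroup of U (which is finite, since U is finitely generated and every finite subgroup of 𝕊¹ is cyclic). Then the connected component of the identity of H equals the topological closure of the subgroup of (𝕊¹)^g generated by u^m = (u₁^m, …, u_g^m). (This is the second part of the structure theorem: SF(A)° = SF(A base-changed to F_{q^m}).) -/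
open MeasureTheory in
/-- A closed subgroup of a finite-dimensional torus is cut out by the characters `z ↦ ∏ zᵢ ^ aᵢ`
which are trivial on it. -/
theorem mem_of_forall_prod_zpow_eq_one {ι : Type*} [Fintype ι] {K : Subgroup (ι → Circle)}
    (hK : IsClosed (K : Set (ι → Circle))) {x : ι → Circle}
    (hx : ∀ a : ι → ℤ, (∀ k ∈ K, ∏ i, k i ^ a i = 1) → ∏ i, x i ^ a i = 1) : x ∈ K := by
  classical
  by_contra hxK
  have : CompactSpace K := isCompact_iff_compactSpace.mp hK.isCompact
  let : MeasurableSpace K := borel K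
  have : BorelSpace K := ⟨rfl⟩
  let μ : Measure K := Measure.haarMeasure ⊤
  have : IsProbabilityMeasure μ :=
    ⟨by simpa using Measure.haarMeasure_self (K₀ := (⊤ : TopologicalSpace.PositiveCompacts K))⟩
  have hcont (f : C(ι → Circle, ℂ)) (y : ι → Circle) : Continuous fun k : K => f (y * k) := by
    fun_prop
  have hint (f : C(ι → Circle, ℂ)) (y : ι → Circle) : Integrable (fun k : K => f (y * k)) μ :=
    (hcont f y).integrable_of_hasCompactSupport (HasCompactSupport.of_compactSpace _)
  let coord (i : ι) : C(ι → Circle, ℂ) := ⟨fun z => z i, by fun_prop⟩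
  let S : Set C(ι → Circle, ℂ) := Set.range coord
  let A : StarSubalgebra ℂ C(ι → Circle, ℂ) := StarAlgebra.adjoin ℂ S
  have hmono : ∀ f ∈ Submonoid.closure (S ∪ star S),
      ∃ a : ι → ℤ, ∀ z, f z = ((∏ i, z i ^ a i : Circle) : ℂ) := by
    intro f hf
    induction hf using Submonoid.closure_induction with
    | mem f hf =>
      rcases hf with ⟨i, rfl⟩ | ⟨i, hi⟩
      · refine ⟨Pi.single i 1, fun z => ?_⟩
        rw [Finset.prod_eq_single i (fun j _ hj => by simp [hj]) (by simp)]
        simp [coord]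
      · refine ⟨Pi.single i (-1), fun z => ?_⟩
        rw [Finset.prod_eq_single i (fun j _ hj => by simp [hj]) (by simp),
          ← star_star f, ← hi]
        simp [coord, ← Circle.coe_inv_eq_conj]
    | one => exact ⟨0, by simp⟩
    | mul f g _ _ hf hg =>
      obtain ⟨a, ha⟩ := hf
      obtain ⟨b, hb⟩ := hg
      exact ⟨a + b, fun z => by simp [ha, hb, zpow_add, Finset.prod_mul_distrib]⟩
  have hA : ∀ f ∈ A, ∫ k : K, f (x * k) ∂μ = ∫ k : K, f (1 * k) ∂μ := by
    intro f hf
    have hf' : f ∈ Submodule.span ℂ (Submonoid.closure (S ∪ star S) : Set C(ι → Circle, ℂ)) := by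
      rw [← Algebra.adjoin_eq_span, ← StarAlgebra.adjoin_toSubalgebra]
      exact hf
    clear hf
    induction hf' using Submodule.span_induction with
    | mem f hf =>
      obtain ⟨a, ha⟩ := hmono f hf
      have hmul (y z : ι → Circle) : f (y * z) = f y * f z := by
        simp [ha, mul_zpow, Finset.prod_mul_distrib]
      simp only [hmul, integral_const_mul]
      have hf1 : f 1 = 1 := by simp [ha]
      by_cases h : ∀ k ∈ K, ∏ i, k i ^ a i = 1
      · rw [hf1, ha x, hx a h]
        simp
      · push Not at h
        obtain ⟨k₀, hk₀, hne⟩ := h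
        have hfk : f k₀ ≠ 1 := by
          rw [ha]
          exact fun h => hne (Circle.ext h)
        have hinv := integral_mul_left_eq_self (μ := μ) (fun k : K => f k) ⟨k₀, hk₀⟩
        simp only [Subgroup.coe_mul, hmul, integral_const_mul] at hinv
        have h0 : ∫ k : K, f k ∂μ = 0 := by
          have : (f k₀ - 1) * ∫ k : K, f k ∂μ = 0 := by rw [sub_mul, hinv, one_mul, sub_self]
          exact (mul_eq_zero.mp this).resolve_left (sub_ne_zero.mpr hfk)
        rw [h0, mul_zero, mul_zero]
    | zero => simp
    | add f g hf hg ihf ihg =>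
      simp only [ContinuousMap.add_apply]
      rw [integral_add (hint f x) (hint g x), integral_add (hint f 1) (hint g 1),
        ihf, ihg]
    | smul c f hf ih =>
      simp only [ContinuousMap.smul_apply]
      rw [integral_smul, integral_smul, ih]
  have hdense : A.topologicalClosure = ⊤ := by
    refine ContinuousMap.starSubalgebra_topologicalClosure_eq_top_of_separatesPoints A ?_
    intro y z hyz
    obtain ⟨i, hi⟩ := Function.ne_iff.mp hyz
    exact ⟨coord i, ⟨coord i, StarAlgebra.subset_adjoin ℂ S ⟨i, rfl⟩, rfl⟩,
      fun h => hi (Circle.ext h)⟩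
  have hdisj : Disjoint (K : Set (ι → Circle)) ((x * ·) '' (K : Set (ι → Circle))) := by
    rw [Set.disjoint_left]
    rintro _ hy ⟨k, hk, rfl⟩
    exact hxK ((Subgroup.mul_mem_cancel_right K hk).mp hy)
  obtain ⟨f, hf0, hf1, -⟩ := exists_continuous_zero_one_of_isClosed hK
    ((Homeomorph.mulLeft x).isClosedMap _ hK) hdisj
  let F : C(ι → Circle, ℂ) := ⟨fun z => (f z : ℂ), by fun_prop⟩
  have hF : F ∈ closure (A : Set C(ι → Circle, ℂ)) := by
    rw [← StarSubalgebra.topologicalClosure_coe, hdense]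
    trivial
  obtain ⟨p, hp, hFp⟩ := Metric.mem_closure_iff.mp hF (1 / 3) (by norm_num)
  have hclose (y : ι → Circle) :
      ‖∫ k : K, F (y * k) ∂μ - ∫ k : K, p (y * k) ∂μ‖ ≤ 1 / 3 := by
    rw [← integral_sub (hint F y) (hint p y)]
    refine (norm_integral_le_of_norm_le_const (C := 1 / 3) (.of_forall fun k => ?_)).trans (by simp)
    rw [← dist_eq_norm]
    exact (ContinuousMap.dist_apply_le_dist _).trans hFp.le
  have h0 : ∫ k : K, F (1 * k) ∂μ = 0 := by
    have (k : K) : F (1 * k) = 0 := by simpa [F] using hf0 k.2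
    simp only [this, integral_zero]
  have h1 : ∫ k : K, F (x * k) ∂μ = 1 := by
    have (k : K) : F (x * k) = 1 := by simpa [F] using hf1 ⟨k, k.2, rfl⟩
    simp [this]
  have hx' := hclose x
  have h1' := hclose 1
  rw [h1, hA p hp] at hx'
  rw [h0, zero_sub, norm_neg] at h1'
  have := norm_sub_norm_le (1 : ℂ) (∫ k : K, p (1 * k) ∂μ)
  rw [norm_one] at this
  linarith

/-- If every character value at `v` of finite order is trivial, then `v` topologically generates a
connected subgroup of the torus. -/
theorem preconnectedSpace_topologicalClosure_zpowers {ι : Type*} [Fintype ι] {v : ι → Circle}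
    (hv : ∀ a : ι → ℤ, IsOfFinOrder (∏ i, v i ^ a i) → ∏ i, v i ^ a i = 1) :
    PreconnectedSpace (Subgroup.zpowers v).topologicalClosure := by
  set C := (Subgroup.zpowers v).topologicalClosure
  have hCc : IsClosed (C : Set (ι → Circle)) := Subgroup.isClosed_topologicalClosure _
  have : CompactSpace C := isCompact_iff_compactSpace.mp hCc.isCompact
  have hvC : v ∈ C := Subgroup.le_topologicalClosure _ (Subgroup.mem_zpowers v)
  suffices h : connectedComponent (1 : C) = Set.univ from
    ⟨h ▸ isPreconnected_connectedComponent⟩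
  rw [connectedComponent_eq_iInter_isClopen, Set.iInter_eq_univ]
  rintro ⟨W, hW, h1W⟩
  obtain ⟨V, hVW⟩ := IsTopologicalGroup.exist_openSubgroup_sub_clopen_nhds_of_one hW h1W
  refine Set.eq_univ_of_forall fun c => hVW ?_
  have : Finite (C ⧸ (V : Subgroup C)) := Subgroup.quotient_finite_of_isOpen _ V.isOpen
  have hfin : (V : Subgroup C).FiniteIndex := Subgroup.finiteIndex_of_finite_quotient
  let K : Subgroup (ι → Circle) := (V : Subgroup C).map C.subtype
  have hK : IsClosed (K : Set (ι → Circle)) :=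
    hCc.isClosedEmbedding_subtypeVal.isClosedMap _ V.isClosed
  have hvK : v ∈ K := by
    refine mem_of_forall_prod_zpow_eq_one hK fun a ha => hv a ?_
    refine isOfFinOrder_iff_pow_eq_one.mpr
      ⟨(V : Subgroup C).index, Nat.pos_of_ne_zero hfin.index_ne_zero, ?_⟩
    rw [← ha (v ^ (V : Subgroup C).index)
      ⟨_, Subgroup.pow_index_mem (V : Subgroup C) ⟨v, hvC⟩, rfl⟩, ← Finset.prod_pow]
    exact Finset.prod_congr rfl fun i _ => by
      rw [Pi.pow_apply, ← zpow_natCast, ← zpow_natCast, zpow_comm]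
  have hCK : C ≤ K := Subgroup.topologicalClosure_minimal _ (by simpa using hvK) hK
  obtain ⟨d, hd, hdc⟩ := hCK c.2
  exact Subtype.ext hdc ▸ hd

/-- The closure of `⟨u ^ m⟩` is open in the closure of `⟨u⟩` for `m ≥ 1`. -/
theorem isOpen_subgroupOf_topologicalClosure_zpowers_pow {G : Type*} [CommGroup G]
    [TopologicalSpace G] [IsTopologicalGroup G] (u : G) {m : ℕ} (hm : 1 ≤ m) :
    IsOpen ((Subgroup.zpowers (u ^ m)).topologicalClosure.subgroupOf
      (Subgroup.zpowers u).topologicalClosure : Set (Subgroup.zpowers u).topologicalClosure) := by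
  set C := (Subgroup.zpowers (u ^ m)).topologicalClosure
  set H := (Subgroup.zpowers u).topologicalClosure
  have hCc : IsClosed (C : Set G) := Subgroup.isClosed_topologicalClosure _
  have huH : u ∈ H := Subgroup.le_topologicalClosure _ (Subgroup.mem_zpowers u)
  have huC : u ^ m ∈ C := Subgroup.le_topologicalClosure _ (Subgroup.mem_zpowers _)
  have hcover : (H : Set G) ⊆ ⋃ i : Fin m, (u ^ (i : ℕ) * ·) '' (C : Set G) := by
    refine closure_minimal ?_ (isClosed_iUnion_of_finite fun i =>
      (Homeomorph.mulLeft (u ^ (i : ℕ))).isClosedMap _ hCc)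
    rintro _ ⟨k, rfl⟩
    have hm0 : (m : ℤ) ≠ 0 := by lia
    have hlt : (k % m).toNat < m := by
      have := Int.emod_nonneg k hm0
      have := Int.emod_lt_of_pos k (by lia : (0 : ℤ) < m)
      lia
    refine Set.mem_iUnion.mpr ⟨⟨_, hlt⟩, (u ^ m) ^ (k / m), zpow_mem huC _, ?_⟩
    change u ^ (k % m).toNat * (u ^ m) ^ (k / m) = u ^ k
    rw [← zpow_natCast u m, ← zpow_natCast u (k % m).toNat,
      Int.toNat_of_nonneg (Int.emod_nonneg k hm0), ← zpow_mul, ← zpow_add, Int.emod_add_mul_ediv]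
  have hsurj : Function.Surjective
      fun i : Fin m => (((⟨u, huH⟩ : H) ^ (i : ℕ) : H) : H ⧸ C.subgroupOf H) := by
    intro q
    induction q using QuotientGroup.induction_on with
    | H h =>
      obtain ⟨i, c, hc, hic⟩ := Set.mem_iUnion.mp (hcover h.2)
      refine ⟨i, QuotientGroup.eq.mpr (Subgroup.mem_subgroupOf.mpr ?_)⟩
      have : ((u ^ (i : ℕ))⁻¹ * (h : G)) = c := by rw [← hic]; simp
      simpa [this] using hc
  have : Finite (H ⧸ C.subgroupOf H) := Finite.of_surjective _ hsurj
  have : (C.subgroupOf H).FiniteIndex := Subgroup.finiteIndex_of_finite_quotient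
  exact Subgroup.isOpen_of_isClosed_of_finiteIndex _ (hCc.preimage continuous_subtype_val)

/-- **Identity component of the Serre–Frobenius group.**
Let `H` be the closure of the subgroup of `(𝕊¹)^g` generated by `u`, let `U` be the
subgroup of `𝕊¹` generated by the coordinates of `u`, and let `m ≥ 1` be the order of the
torsion subgroup of `U`.  Then the connected component of the identity of `H` is the closure
of the subgroup generated by `u^m = (u₁^m, …, u_g^m)`. -/
theorem serre_frobenius_identity_component (g m : ℕ) (hm : 1 ≤ m) (u : Fin g → Circle)
    (U : Subgroup Circle) (hU : U = Subgroup.closure (Set.range u))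
    (hmU : Nat.card (CommGroup.torsion U) = m)
    (H : Subgroup (Fin g → Circle))
    (hH : H = (Subgroup.closure {u}).topologicalClosure) :
    Subtype.val '' connectedComponent (1 : H) =
      ((Subgroup.closure {fun i => u i ^ m}).topologicalClosure : Set (Fin g → Circle)) := by
  rw [← Subgroup.zpowers_eq_closure] at hH ⊢
  subst hH
  change _ = ((Subgroup.zpowers (u ^ m)).topologicalClosure : Set (Fin g → Circle))
  have hopen := isOpen_subgroupOf_topologicalClosure_zpowers_pow u hm
  have hconn : PreconnectedSpace (Subgroup.zpowers (u ^ m)).topologicalClosure := by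
    refine preconnectedSpace_topologicalClosure_zpowers fun a ha => ?_
    have hpow : ∏ i, (u ^ m) i ^ a i = (∏ i, u i ^ a i) ^ m := by
      rw [← Finset.prod_pow]
      exact Finset.prod_congr rfl fun i _ => by
        rw [Pi.pow_apply, ← zpow_natCast, ← zpow_natCast, zpow_comm]
    rw [hpow] at ha ⊢
    have hzU : ∏ i, u i ^ a i ∈ U := hU ▸ Subgroup.prod_mem _ fun i _ =>
      zpow_mem (Subgroup.subset_closure (Set.mem_range_self i)) _
    have htors : (⟨_, hzU⟩ : U) ∈ CommGroup.torsion U :=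
      Submonoid.isOfFinOrder_coe.mp (ha.of_pow (by lia))
    have := pow_card_eq_one' (x := (⟨_, htors⟩ : CommGroup.torsion U))
    rw [hmU] at this
    exact congrArg (fun t : CommGroup.torsion U => ((t : U) : Circle)) this
  set C := (Subgroup.zpowers (u ^ m)).topologicalClosure
  set H := (Subgroup.zpowers u).topologicalClosure
  have hCH : C ≤ H := Subgroup.topologicalClosure_mono (by simp)
  apply Set.Subset.antisymm
  · have hclopen : IsClopen (C.subgroupOf H : Set H) :=
      ⟨Subgroup.isClosed_of_isOpen _ hopen, hopen⟩
    rintro _ ⟨h, hh, rfl⟩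
    exact hclopen.connectedComponent_subset (one_mem (C.subgroupOf H)) hh
  · intro c hc
    refine ⟨⟨c, hCH hc⟩, ?_, rfl⟩
    exact (isPreconnected_range (continuous_inclusion hCH)).subset_connectedComponent
      ⟨1, rfl⟩ ⟨⟨c, hc⟩, rfl⟩
end

section
/- Let u = (u₁, …, u_g) ∈ (𝕊¹)^g, let H be the topological closure of the subgroup of (𝕊¹)^g generated by u, and let U be the subgroup of 𝕊¹ generated by {u₁, …, u_g}. Then the evaluation map sending a continuous group homomorphism φ : H → 𝕊¹ to the value φ(u) is an injective group homomorphism from the group of continuous characters of H (the Pontryagin dual of H) to 𝕊¹, and its image is exactly U. In particular, the Pontryagin dual of H is isomorphic as an abstract group to U. -/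
namespace PontryaginDual

variable {G : Type*} [Group G] [TopologicalSpace G]

/-- A character, viewed as a continuous complex-valued function. -/
noncomputable def toComplex (φ : PontryaginDual G) : C(G, ℂ) where
  toFun x := φ x
  continuous_toFun := continuous_subtype_val.comp (map_continuous φ)

@[simp]
theorem toComplex_apply (φ : PontryaginDual G) (x : G) : toComplex φ x = φ x := rfl

theorem mul_apply (φ ψ : PontryaginDual G) (x : G) : (φ * ψ) x = φ x * ψ x := rfl

theorem inv_apply (φ : PontryaginDual G) (x : G) : φ⁻¹ x = (φ x)⁻¹ := rfl

/-- Evaluation of characters at a point. -/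
noncomputable def evalHom (x : G) : PontryaginDual G →* Circle where
  toFun φ := φ x
  map_one' := rfl
  map_mul' _ _ := rfl

/-- Trigonometric polynomials with frequencies in a subgroup `S` of the dual. -/
noncomputable def trigPolynomial (S : Subgroup (PontryaginDual G)) : StarSubalgebra ℂ C(G, ℂ) where
  toSubalgebra := Algebra.adjoin ℂ (toComplex '' S)
  star_mem' := by
    change Algebra.adjoin ℂ (toComplex '' (S : Set (PontryaginDual G))) ≤
      star (Algebra.adjoin ℂ (toComplex '' (S : Set (PontryaginDual G))))
    refine Algebra.adjoin_le ?_
    rintro - ⟨ψ, hψ, rfl⟩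
    refine Algebra.subset_adjoin ⟨ψ⁻¹, S.inv_mem hψ, ?_⟩
    ext x
    simp [inv_apply, ← Circle.coe_inv_eq_conj]

theorem toSubmodule_trigPolynomial (S : Subgroup (PontryaginDual G)) :
    Subalgebra.toSubmodule (trigPolynomial S).toSubalgebra =
      Submodule.span ℂ (toComplex '' S) := by
  refine Algebra.adjoin_eq_span_of_subset _ (Set.Subset.trans ?_ Submodule.subset_span)
  intro f hf
  refine Submonoid.closure_induction (fun _ => id) ⟨1, S.one_mem, ?_⟩ ?_ hf
  · ext x
    simp
  · rintro - - - - ⟨φ, hφ, rfl⟩ ⟨ψ, hψ, rfl⟩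
    refine ⟨φ * ψ, S.mul_mem hφ hψ, ?_⟩
    ext x
    simp [mul_apply]

/-- If no character in `S` takes the value `z` at `x`, then the exponential sums of a trigonometric
polynomial with frequencies in `S` along the powers of `x`, twisted by `z⁻¹`, are bounded. -/
theorem exists_norm_sum_le (S : Subgroup (PontryaginDual G)) (x : G) (z : Circle)
    (hz : ∀ ψ ∈ S, ψ x ≠ z) {f : C(G, ℂ)} (hf : f ∈ trigPolynomial S) :
    ∃ C : ℝ, ∀ N : ℕ, ‖∑ n ∈ Finset.range N, ((z : ℂ)⁻¹) ^ n * f (x ^ n)‖ ≤ C := by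
  replace hf : f ∈ Submodule.span ℂ (toComplex '' (S : Set (PontryaginDual G))) := by
    rw [← toSubmodule_trigPolynomial]
    exact hf
  induction hf using Submodule.span_induction with
  | mem f hf =>
    obtain ⟨ψ, hψ, rfl⟩ := hf
    set w : ℂ := (z : ℂ)⁻¹ * ψ x with hw
    have hw1 : w ≠ 1 := fun h => hz ψ hψ <| Circle.ext <| by
      rwa [hw, inv_mul_eq_one₀ z.coe_ne_zero, eq_comm] at h
    have hwn : ‖w‖ = 1 := by
      rw [hw, norm_mul, norm_inv, Circle.norm_coe, Circle.norm_coe, inv_one, one_mul]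
    refine ⟨2 / ‖w - 1‖, fun N => ?_⟩
    have hsum : ∑ n ∈ Finset.range N, ((z : ℂ)⁻¹) ^ n * toComplex ψ (x ^ n) =
        (w ^ N - 1) / (w - 1) := by
      rw [← geom_sum_eq hw1]
      exact Finset.sum_congr rfl fun n _ => by simp [hw, mul_pow]
    rw [hsum, norm_div]
    gcongr
    calc ‖w ^ N - 1‖ ≤ ‖w ^ N‖ + ‖(1 : ℂ)‖ := norm_sub_le _ _
      _ = 2 := by rw [norm_pow, hwn]; norm_num
  | zero => exact ⟨0, fun N => by simp⟩
  | add f g _ _ ihf ihg =>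
    obtain ⟨C, hC⟩ := ihf
    obtain ⟨D, hD⟩ := ihg
    refine ⟨C + D, fun N => ?_⟩
    simp only [ContinuousMap.add_apply, mul_add, Finset.sum_add_distrib]
    exact norm_add_le_of_le (hC N) (hD N)
  | smul c f _ ih =>
    obtain ⟨C, hC⟩ := ih
    refine ⟨‖c‖ * C, fun N => ?_⟩
    simp only [ContinuousMap.smul_apply, smul_eq_mul, mul_left_comm _ c, ← Finset.mul_sum,
      norm_mul]
    exact mul_le_mul_of_nonneg_left (hC N) (norm_nonneg c)

/-- On a compact group, every value at `x` of a character is already attained by a character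
in any given subgroup of the dual that separates points. -/
theorem exists_mem_apply_eq [CompactSpace G] (S : Subgroup (PontryaginDual G))
    (hS : ∀ a b : G, a ≠ b → ∃ ψ ∈ S, ψ a ≠ ψ b) (x : G) (φ : PontryaginDual G) :
    ∃ ψ ∈ S, ψ x = φ x := by
  by_contra! hne
  have hsep : (trigPolynomial S).SeparatesPoints := by
    intro a b hab
    obtain ⟨ψ, hψ, h⟩ := hS a b hab
    exact ⟨toComplex ψ, ⟨toComplex ψ, Algebra.subset_adjoin ⟨ψ, hψ, rfl⟩, rfl⟩,
      fun he => h (Circle.ext he)⟩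
  have hφ : toComplex φ ∈ closure (trigPolynomial S : Set C(G, ℂ)) := by
    rw [← StarSubalgebra.topologicalClosure_coe,
      ContinuousMap.starSubalgebra_topologicalClosure_eq_top_of_separatesPoints _ hsep]
    trivial
  obtain ⟨f, hf, hfφ⟩ := Metric.mem_closure_iff.1 hφ (1 / 2) (by norm_num)
  obtain ⟨C, hC⟩ := exists_norm_sum_le S x (φ x) hne hf
  have hbound (N : ℕ) : (N : ℝ) ≤ N * (1 / 2) + C := by
    have hsum : (N : ℂ) = ∑ n ∈ Finset.range N,
          ((φ x : ℂ)⁻¹) ^ n * (toComplex φ (x ^ n) - f (x ^ n)) +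
        ∑ n ∈ Finset.range N, ((φ x : ℂ)⁻¹) ^ n * f (x ^ n) := by
      rw [← Finset.sum_add_distrib]
      simp [← mul_add]
    have hle : ‖∑ n ∈ Finset.range N,
        ((φ x : ℂ)⁻¹) ^ n * (toComplex φ (x ^ n) - f (x ^ n))‖ ≤ N * (1 / 2) := by
      refine (norm_sum_le_of_le _ (f := fun n => ((φ x : ℂ)⁻¹) ^ n *
        (toComplex φ (x ^ n) - f (x ^ n))) (n := fun _ => 1 / 2) fun n _ => ?_).trans (by simp)
      rw [norm_mul, norm_pow, norm_inv, Circle.norm_coe, inv_one, one_pow, one_mul, ← dist_eq_norm]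
      exact (ContinuousMap.dist_apply_le_dist _).trans hfφ.le
    calc (N : ℝ) = ‖(N : ℂ)‖ := (Complex.norm_natCast N).symm
      _ ≤ N * (1 / 2) + C := by
        rw [hsum]
        exact norm_add_le_of_le hle (hC N)
  obtain ⟨N, hN⟩ := exists_nat_gt (2 * C)
  linarith [hbound N]

/-- A character of a group that is topologically generated by `x` is determined by its value
at `x`. -/
theorem evalHom_injective {x : G} (hx : Dense (Subgroup.closure {x} : Set G)) :
    Function.Injective (evalHom x) := by
  intro φ ψ h
  refine DFunLike.coe_injective <| Continuous.ext_on hx (map_continuous φ) (map_continuous ψ) ?_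
  intro y hy
  obtain ⟨n, rfl⟩ := Subgroup.mem_closure_singleton.1 hy
  simp only [map_zpow]
  exact congrArg (· ^ n) h

end PontryaginDual

/-- If `H` is topologically generated by `x`, the subgroup generated by `x` is dense in `H`. -/
theorem Subgroup.dense_closure_singleton_of_eq_topologicalClosure {G : Type*} [Group G]
    [TopologicalSpace G] [IsTopologicalGroup G] {H : Subgroup G} {x : G}
    (hH : H = (Subgroup.closure {x}).topologicalClosure) (hx : x ∈ H) :
    Dense (Subgroup.closure {(⟨x, hx⟩ : H)} : Set H) := by
  have himage : Subtype.val '' (Subgroup.closure {(⟨x, hx⟩ : H)} : Set H) =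
      (Subgroup.closure {x} : Set G) := by
    rw [← Subgroup.coe_subtype, ← Subgroup.coe_map, MonoidHom.map_closure, Set.image_singleton]
    rfl
  intro y
  rw [closure_subtype, himage, ← Subgroup.topologicalClosure_coe, ← hH]
  exact y.2

/-- **The character group of the Serre–Frobenius group is the angle group.**
Let `H` be the closure of the subgroup of `(𝕊¹)^g` generated by `u` and let `U` be the
subgroup of `𝕊¹` generated by the coordinates of `u`.  Evaluation at `u` is an injective
group homomorphism from the Pontryagin dual of `H` to `𝕊¹` with image exactly `U`; in
particular the Pontryagin dual of `H` is isomorphic as an abstract group to `U`. -/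
theorem pontryagin_dual_eq_angle_group (g : ℕ) (u : Fin g → Circle)
    (H : Subgroup (Fin g → Circle))
    (hH : H = (Subgroup.closure {u}).topologicalClosure)
    (hu : u ∈ H)
    (U : Subgroup Circle) (hU : U = Subgroup.closure (Set.range u)) :
    Function.Injective (fun φ : PontryaginDual H => φ ⟨u, hu⟩) ∧
      (∀ φ ψ : PontryaginDual H, (φ * ψ) ⟨u, hu⟩ = φ ⟨u, hu⟩ * ψ ⟨u, hu⟩) ∧
      Set.range (fun φ : PontryaginDual H => φ ⟨u, hu⟩) = (U : Set Circle) ∧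
      Nonempty (PontryaginDual H ≃* U) := by
  have : CompactSpace H := isCompact_iff_compactSpace.1 <| IsClosed.isCompact <| by
    rw [hH]
    exact Subgroup.isClosed_topologicalClosure _
  set x : H := ⟨u, hu⟩
  let coord (i : Fin g) : PontryaginDual H :=
    (⟨(Pi.evalMonoidHom (fun _ : Fin g => Circle) i).comp H.subtype,
      (continuous_apply i).comp continuous_subtype_val⟩ : H →ₜ* Circle)
  have hinj : Function.Injective (PontryaginDual.evalHom x) :=
    PontryaginDual.evalHom_injective
      (Subgroup.dense_closure_singleton_of_eq_topologicalClosure hH hu)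
  have hmap : (Subgroup.closure (Set.range coord)).map (PontryaginDual.evalHom x) = U := by
    rw [MonoidHom.map_closure, ← Set.range_comp, hU]
    rfl
  have hsep (a b : H) (hab : a ≠ b) :
      ∃ ψ ∈ Subgroup.closure (Set.range coord), ψ a ≠ ψ b := by
    obtain ⟨i, hi⟩ := Function.ne_iff.1 (Subtype.coe_ne_coe.2 hab)
    exact ⟨coord i, Subgroup.subset_closure ⟨i, rfl⟩, hi⟩
  have hrange : (PontryaginDual.evalHom x).range = U := by
    refine le_antisymm ?_ (hmap ▸ Subgroup.map_le_range _ _)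
    rintro _ ⟨φ, rfl⟩
    obtain ⟨ψ, hψ, h⟩ := PontryaginDual.exists_mem_apply_eq _ hsep x φ
    rw [← hmap]
    exact ⟨ψ, hψ, h⟩
  refine ⟨hinj, fun _ _ => rfl, ?_, ⟨?_⟩⟩
  · rw [← hrange]
    rfl
  · exact (MonoidHom.ofInjective hinj).trans (MulEquiv.subgroupCongr hrange)
end

section
/- Let u = (u₁, …, u_g) ∈ (𝕊¹)^g, let H be the topological closure of the subgroup of (𝕊¹)^g generated by u, and let μ_H be the Haar probability measure on H. For each integer r ≥ 1 set x_r = ∑_{i=1}^g (u_i^r + conj(u_i)^r) = ∑_{i=1}^g 2·Re(u_i^r) ∈ [−2g, 2g]. Then for every continuous function f : ℝ → ℂ, the averages (1/n) ∑_{r=1}^n f(x_r) converge to ∫_H f(∑_{i=1}^g 2·Re(z_i)) dμ_H(z₁, …, z_g) as n → ∞. (Applied to the normalized Frobenius eigenvalues of a g-dimensional abelian variety over F_q, this says the sequence of normalized Frobenius traces is equidistributed in [−2g, 2g] with respect to the pushforward of the Haar measure on the Serre–Frobenius group.) -/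
open Filter Topology MeasureTheory

/-- Borel measurable structure on a subgroup of a topological group. -/
noncomputable instance subgroupMeasurableSpace {G : Type*} [Group G] [TopologicalSpace G]
    (K : Subgroup G) : MeasurableSpace K := borel K

instance subgroupBorelSpace {G : Type*} [Group G] [TopologicalSpace G]
    (K : Subgroup G) : BorelSpace K := ⟨rfl⟩

/-- If `a` has dense integer powers in a topological group, then a nontrivial unitary character is
not trivial at `a`. -/
theorem ContinuousMonoidHom.eq_one_of_dense_zpowers {H : Type*} [Group H] [TopologicalSpace H]
    {a : H} (ha : Dense (Subgroup.zpowers a : Set H)) (χ : H →ₜ* Circle) (h : χ a = 1) (z : H) :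
    χ z = 1 := by
  have : (χ : H → Circle) = fun _ => 1 := by
    refine Continuous.ext_on ha (map_continuous χ) continuous_const ?_
    rintro _ ⟨k, rfl⟩
    simp [map_zpow, h]
  exact congrFun this z

/-- The Cesàro averages of the powers of a point `w ≠ 1` of the unit circle tend to zero. -/
theorem Circle.tendsto_average_pow_of_ne_one {w : Circle} (hw : w ≠ 1) :
    Tendsto (fun n : ℕ => (n : ℂ)⁻¹ • ∑ r ∈ Finset.Icc 1 n, (w : ℂ) ^ r) atTop (𝓝 0) := by
  have hw' : (w : ℂ) ≠ 1 := fun h => hw (Circle.ext h)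
  have hbound (n : ℕ) : ‖∑ r ∈ Finset.Icc 1 n, (w : ℂ) ^ r‖ ≤ 2 / ‖(w : ℂ) - 1‖ := by
    rw [← Finset.Ico_add_one_right_eq_Icc, geom_sum_Ico hw' (by omega), norm_div]
    gcongr
    refine (norm_sub_le _ _).trans ?_
    simp only [norm_pow, Circle.norm_coe, one_pow]
    norm_num
  refine squeeze_zero_norm (a := fun n : ℕ => (n : ℝ)⁻¹ * (2 / ‖(w : ℂ) - 1‖)) (fun n => ?_) ?_
  · rw [norm_smul, norm_inv, Complex.norm_natCast]
    gcongr
    exact hbound n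
  · simpa using (tendsto_inv_atTop_nhds_zero_nat (𝕜 := ℝ)).mul_const (2 / ‖(w : ℂ) - 1‖)

/-- A nontrivial unitary character integrates to zero against a left-invariant measure. -/
theorem ContinuousMonoidHom.integral_eq_zero {H : Type*} [Group H] [TopologicalSpace H]
    [MeasurableSpace H] [MeasurableMul H] (μ : Measure H) [μ.IsMulLeftInvariant]
    (χ : H →ₜ* Circle) {a : H} (h : χ a ≠ 1) : ∫ z, (χ z : ℂ) ∂μ = 0 := by
  have key : ∫ z, (χ (a * z) : ℂ) ∂μ = ∫ z, (χ z : ℂ) ∂μ :=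
    integral_mul_left_eq_self (fun z => (χ z : ℂ)) a
  simp only [map_mul, Circle.coe_mul, integral_const_mul] at key
  have h' : (χ a : ℂ) - 1 ≠ 0 := sub_ne_zero.2 fun h1 => h (Circle.ext h1)
  refine (mul_eq_zero.1 (?_ : ((χ a : ℂ) - 1) * _ = 0)).resolve_left h'
  rw [sub_mul, key, one_mul, sub_self]

/-- A unitary character as a complex-valued continuous function. -/
noncomputable def ContinuousMonoidHom.toComplexMap {H : Type*} [Group H] [TopologicalSpace H]
    (χ : H →ₜ* Circle) : C(H, ℂ) where
  toFun z := χ z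
  continuous_toFun := by fun_prop

/-- If unitary characters separate the points of a compact group, then their linear span is dense
in the continuous functions. -/
theorem ContinuousMonoidHom.topologicalClosure_span_eq_top {H : Type*} [Group H]
    [TopologicalSpace H] [CompactSpace H]
    (hsep : ∀ x y : H, x ≠ y → ∃ χ : H →ₜ* Circle, χ x ≠ χ y) :
    (Submodule.span ℂ
      (Set.range (toComplexMap : (H →ₜ* Circle) → C(H, ℂ)))).topologicalClosure = ⊤ := by
  let M : Submonoid C(H, ℂ) :=
    { carrier := Set.range toComplexMap
      one_mem' := ⟨1, by ext; simp [toComplexMap]⟩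
      mul_mem' := by
        rintro _ _ ⟨χ, rfl⟩ ⟨ψ, rfl⟩
        exact ⟨χ * ψ, by ext; simp [toComplexMap]⟩ }
  have hM : (M : Set C(H, ℂ)) = Set.range toComplexMap := rfl
  let A : StarSubalgebra ℂ C(H, ℂ) :=
    { Algebra.adjoin ℂ (M : Set C(H, ℂ)) with
      star_mem' := by
        change Algebra.adjoin ℂ (M : Set C(H, ℂ)) ≤ star (Algebra.adjoin ℂ (M : Set C(H, ℂ)))
        refine Algebra.adjoin_le ?_
        rintro _ ⟨χ, rfl⟩
        refine Algebra.subset_adjoin ⟨χ⁻¹, ?_⟩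
        ext z
        exact Circle.coe_inv_eq_conj (χ z) }
  have hA : A.toSubalgebra.SeparatesPoints := by
    intro x y hxy
    obtain ⟨χ, hχ⟩ := hsep x y hxy
    exact ⟨_, ⟨toComplexMap χ, Algebra.subset_adjoin ⟨χ, rfl⟩, rfl⟩,
      fun h => hχ (Circle.ext h)⟩
  have hspan : Subalgebra.toSubmodule A.toSubalgebra = Submodule.span ℂ (M : Set C(H, ℂ)) := by
    change Subalgebra.toSubmodule (Algebra.adjoin ℂ (M : Set C(H, ℂ))) = _
    rw [Algebra.adjoin_eq_span, Submonoid.closure_eq]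
  rw [← hM, ← hspan]
  exact congrArg (fun B : StarSubalgebra ℂ C(H, ℂ) => Subalgebra.toSubmodule B.toSubalgebra)
    (ContinuousMap.starSubalgebra_topologicalClosure_eq_top_of_separatesPoints A hA)

/-- Weyl equidistribution: in a compact group whose points are separated by unitary characters,
the powers of a topological generator are equidistributed for the Haar probability measure. -/
theorem tendsto_average_pow_of_dense_zpowers {H : Type*} [Group H] [TopologicalSpace H]
    [IsTopologicalGroup H] [CompactSpace H] [MeasurableSpace H] [BorelSpace H] (μ : Measure H)
    [μ.IsMulLeftInvariant] [IsProbabilityMeasure μ]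
    (hsep : ∀ x y : H, x ≠ y → ∃ χ : H →ₜ* Circle, χ x ≠ χ y)
    {a : H} (ha : Dense (Subgroup.zpowers a : Set H)) (F : C(H, ℂ)) :
    Tendsto (fun n : ℕ => (n : ℂ)⁻¹ • ∑ r ∈ Finset.Icc 1 n, F (a ^ r)) atTop
      (𝓝 (∫ z, F z ∂μ)) := by
  have hint (F : C(H, ℂ)) : Integrable F μ := F.continuous.integrable_of_hasCompactSupport
    (HasCompactSupport.of_compactSpace _)
  have hspan : ∀ F ∈ Submodule.span ℂ
      (Set.range (ContinuousMonoidHom.toComplexMap : (H →ₜ* Circle) → C(H, ℂ))),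
      Tendsto (fun n : ℕ => (n : ℂ)⁻¹ • ∑ r ∈ Finset.Icc 1 n, F (a ^ r)) atTop
        (𝓝 (∫ z, F z ∂μ)) := by
    intro F hF
    induction hF using Submodule.span_induction with
    | mem F hF =>
      obtain ⟨χ, rfl⟩ := hF
      change Tendsto (fun n : ℕ => (n : ℂ)⁻¹ • ∑ r ∈ Finset.Icc 1 n, (χ (a ^ r) : ℂ)) atTop
        (𝓝 (∫ z, (χ z : ℂ) ∂μ))
      by_cases h : χ a = 1
      · simp only [χ.eq_one_of_dense_zpowers ha h]
        refine (tendsto_const_nhds (x := (1 : ℂ))).congr' ?_ |>.trans (by simp)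
        filter_upwards [eventually_ne_atTop 0] with n hn
        have : (n : ℂ) ≠ 0 := by exact_mod_cast hn
        simp [this]
      · rw [χ.integral_eq_zero μ h]
        simpa using Circle.tendsto_average_pow_of_ne_one h
    | zero => simp
    | add F G _ _ hF hG =>
      simpa [Finset.sum_add_distrib, mul_add, integral_add (hint F) (hint G)] using hF.add hG
    | smul c F _ hF =>
      simpa [← Finset.mul_sum, mul_left_comm, integral_const_mul] using hF.const_mul c
  rw [Metric.tendsto_atTop]
  intro ε hε
  have hF : F ∈ closure (Submodule.span ℂ
      (Set.range (ContinuousMonoidHom.toComplexMap : (H →ₜ* Circle) → C(H, ℂ))) :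
        Set C(H, ℂ)) := by
    rw [← Submodule.topologicalClosure_coe,
      ContinuousMonoidHom.topologicalClosure_span_eq_top hsep]
    trivial
  obtain ⟨G, hG, hFG⟩ := Metric.mem_closure_iff.1 hF (ε / 3) (by positivity)
  obtain ⟨N, hN⟩ := Metric.tendsto_atTop.1 (hspan G hG) (ε / 3) (by positivity)
  refine ⟨N, fun n hn => ?_⟩
  have hpt (z : H) : ‖F z - G z‖ ≤ dist F G := by
    rw [← dist_eq_norm]
    exact ContinuousMap.dist_apply_le_dist z
  have hsum : dist ((n : ℂ)⁻¹ • ∑ r ∈ Finset.Icc 1 n, F (a ^ r))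
      ((n : ℂ)⁻¹ • ∑ r ∈ Finset.Icc 1 n, G (a ^ r)) ≤ dist F G := by
    rw [dist_eq_norm, ← smul_sub, ← Finset.sum_sub_distrib, norm_smul, norm_inv,
      Complex.norm_natCast]
    calc (n : ℝ)⁻¹ * ‖∑ r ∈ Finset.Icc 1 n, (F (a ^ r) - G (a ^ r))‖
        ≤ (n : ℝ)⁻¹ * (n * dist F G) := by
          gcongr
          simpa using norm_sum_le_of_le (Finset.Icc 1 n) fun r _ => hpt (a ^ r)
      _ ≤ dist F G := by
          rw [← mul_assoc]
          exact mul_le_of_le_one_left dist_nonneg inv_mul_le_one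
  have hintegral : dist (∫ z, G z ∂μ) (∫ z, F z ∂μ) ≤ dist F G := by
    rw [dist_comm, dist_eq_norm, ← integral_sub (hint F) (hint G)]
    simpa using norm_integral_le_of_norm_le_const (μ := μ) (.of_forall hpt)
  have hn' := hN n hn
  refine (dist_triangle4 _ ((n : ℂ)⁻¹ • ∑ r ∈ Finset.Icc 1 n, G (a ^ r)) (∫ z, G z ∂μ) _)
    |>.trans_lt ?_
  linarith

/-- The points of a subgroup of a torus are separated by unitary characters. -/
theorem exists_continuousMonoidHom_circle_ne {ι : Type*} (K : Subgroup (ι → Circle)) (x y : K)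
    (hxy : x ≠ y) : ∃ χ : K →ₜ* Circle, χ x ≠ χ y := by
  obtain ⟨i, hi⟩ := Function.ne_iff.1 (Subtype.coe_injective.ne hxy)
  exact ⟨⟨(Pi.evalMonoidHom _ i).comp K.subtype,
    (continuous_apply i).comp continuous_subtype_val⟩, hi⟩

/-- An element of a topological group has dense powers in the closed subgroup it generates. -/
theorem Subgroup.dense_zpowers_topologicalClosure {G : Type*} [Group G] [TopologicalSpace G]
    [IsTopologicalGroup G] {u : G} (hu : u ∈ (closure {u}).topologicalClosure) :
    Dense (zpowers (⟨u, hu⟩ : (closure {u}).topologicalClosure) :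
      Set (closure {u}).topologicalClosure) := by
  intro z
  rw [closure_subtype]
  have himage : Subtype.val '' (zpowers (⟨u, hu⟩ : (closure {u}).topologicalClosure) :
      Set (closure {u}).topologicalClosure) = (closure {u} : Set G) := by
    ext w
    simp [mem_zpowers_iff, mem_closure_singleton, Subtype.ext_iff]
    rintro k rfl
    exact zpow_mem hu k
  rw [himage]
  exact z.2

/-- **Equidistribution of normalized Frobenius traces.**
Let `H` be the closure of the subgroup of `(𝕊¹)^g` generated by `u = (u₁, …, u_g)`, with
Haar probability measure `μ`.  Setting `x_r = ∑ᵢ 2·Re(uᵢ^r) ∈ [-2g, 2g]`, for every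
continuous `f : ℝ → ℂ` the averages `(1/n) ∑_{r=1}^n f (x_r)` converge to
`∫_H f (∑ᵢ 2·Re(zᵢ)) dμ(z)`. -/
theorem traces_equidistributed (g : ℕ) (u : Fin g → Circle)
    (μ : Measure ((Subgroup.closure {u} : Subgroup (Fin g → Circle)).topologicalClosure))
    [μ.IsHaarMeasure] [IsProbabilityMeasure μ] :
    ∀ f : ℝ → ℂ, Continuous f →
      Tendsto
        (fun n : ℕ => (n : ℂ)⁻¹ • ∑ r ∈ Finset.Icc 1 n, f (∑ i, 2 * ((u i : ℂ) ^ r).re))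
        atTop
        (𝓝 (∫ z : (Subgroup.closure {u} : Subgroup (Fin g → Circle)).topologicalClosure,
              f (∑ i, 2 * (((z : Fin g → Circle) i : ℂ)).re) ∂μ)) := by
  intro f hf
  have hu : u ∈ (Subgroup.closure {u}).topologicalClosure :=
    Subgroup.le_topologicalClosure _ (Subgroup.subset_closure rfl)
  have : CompactSpace (Subgroup.closure {u}).topologicalClosure :=
    isCompact_iff_compactSpace.1 (Subgroup.isClosed_topologicalClosure _).isCompact
  have hcont : Continuous fun z : (Subgroup.closure {u}).topologicalClosure =>
      f (∑ i, 2 * (((z : Fin g → Circle) i : ℂ)).re) := by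
    refine hf.comp (continuous_finsetSum _ fun i _ => continuous_const.mul ?_)
    exact Complex.continuous_re.comp
      (continuous_subtype_val.comp ((continuous_apply i).comp continuous_subtype_val))
  exact tendsto_average_pow_of_dense_zpowers μ (exists_continuousMonoidHom_circle_ne _)
    (Subgroup.dense_zpowers_topologicalClosure hu)
    ⟨_, hcont⟩
end

section
/- Let q be a positive integer, let a be an integer with a² ≤ 4q, and let α ∈ ℂ be a root of the quadratic polynomial X² − aX + q. If α/√q is a root of unity, then its multiplicative order belongs to the set {1, 2, 3, 4, 6, 8, 12}. (This is the arithmetic core of the supersingular case of Theorem A: the possible finite Serre–Frobenius groups of elliptic curves over F_q are cyclic of order in this set.) -/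
/-- A rational number of the form `z + z⁻¹`, with `z` a complex root of unity, is an integer. -/
lemma exists_int_of_pow_eq_one_of_add_inv {z : ℂ} {n : ℕ} (hn : 0 < n) (hz : z ^ n = 1) {r : ℚ}
    (h : z + z⁻¹ = (r : ℂ)) : ∃ m : ℤ, (m : ℚ) = r := by
  have hz' : IsIntegral ℤ z := .of_pow hn (hz ▸ isIntegral_one)
  have hinv : IsIntegral ℤ z⁻¹ := .of_pow hn (by rw [inv_pow, hz, inv_one]; exact isIntegral_one)
  have hr : IsIntegral ℤ (algebraMap ℚ ℂ r) := by
    rw [eq_ratCast, ← h]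
    exact hz'.add hinv
  obtain ⟨m, hm⟩ := IsIntegrallyClosed.isIntegral_iff.mp
    ((isIntegral_algebraMap_iff (algebraMap ℚ ℂ).injective).mp hr)
  exact ⟨m, by simpa using hm⟩

/-- **Possible orders of supersingular normalized Frobenius eigenvalues of elliptic curves.**
Let `q` be a positive integer, `a` an integer with `a² ≤ 4q`, and `α ∈ ℂ` a root of
`X² - aX + q`.  If `α/√q` is a root of unity of (least) order `n`, then
`n ∈ {1, 2, 3, 4, 6, 8, 12}`. -/
theorem supersingular_orders (q : ℕ) (hq : 0 < q) (a : ℤ) (ha : a ^ 2 ≤ 4 * (q : ℤ))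
    (α : ℂ) (hα : α ^ 2 - (a : ℂ) * α + (q : ℂ) = 0)
    (n : ℕ) (hn : 0 < n) (hroot : (α / (Real.sqrt q : ℂ)) ^ n = 1)
    (hleast : ∀ k : ℕ, 0 < k → (α / (Real.sqrt q : ℂ)) ^ k = 1 → n ≤ k) :
    n ∈ ({1, 2, 3, 4, 6, 8, 12} : Set ℕ) := by
  have hs : (Real.sqrt q : ℂ) ^ 2 = q := by
    exact_mod_cast Real.sq_sqrt (Nat.cast_nonneg q)
  have hqC : (q : ℂ) ≠ 0 := by exact_mod_cast hq.ne'
  have hs0 : (Real.sqrt q : ℂ) ≠ 0 := fun h ↦ hqC (by rw [← hs, h]; simp)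
  obtain ⟨u, hu⟩ : ∃ u, u = α / (Real.sqrt q : ℂ) := ⟨_, rfl⟩
  rw [← hu] at hroot hleast
  have hαu : α = u * (Real.sqrt q : ℂ) := by rw [hu, div_mul_cancel₀ _ hs0]
  have hu0 : u ≠ 0 := by
    rintro rfl
    simp [hn.ne'] at hroot
  have hlin : (Real.sqrt q : ℂ) * (u ^ 2 + 1) = a * u := by
    apply mul_left_cancel₀ hs0
    rw [hαu] at hα
    linear_combination hα + hs
  have hquad : (q : ℂ) * (u ^ 2 + 1) ^ 2 = (a : ℂ) ^ 2 * u ^ 2 := by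
    linear_combination ((Real.sqrt q : ℂ) * (u ^ 2 + 1) + a * u) * hlin - (u ^ 2 + 1) ^ 2 * hs
  have htrace : u ^ 2 + (u ^ 2)⁻¹ = (((a : ℚ) ^ 2 / q - 2 : ℚ) : ℂ) := by
    push_cast
    field_simp
    linear_combination hquad
  obtain ⟨m, hm⟩ := exists_int_of_pow_eq_one_of_add_inv hn
    (by rw [← pow_mul, mul_comm, pow_mul, hroot, one_pow]) htrace
  have hqQ : (0 : ℚ) < q := by exact_mod_cast hq
  have hle : (m : ℚ) ≤ 2 := by
    have : (a : ℚ) ^ 2 / q ≤ 4 := by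
      rw [div_le_iff₀ hqQ]
      exact_mod_cast ha
    linarith
  have hge : (-2 : ℚ) ≤ m := by
    have : 0 ≤ (a : ℚ) ^ 2 / q := by positivity
    linarith
  have hle' : m ≤ 2 := by exact_mod_cast hle
  have hge' : -2 ≤ m := by exact_mod_cast hge
  rw [← hm] at htrace
  have hpoly : u ^ 4 - (m : ℂ) * u ^ 2 + 1 = 0 := by
    push_cast at htrace
    field_simp at htrace
    linear_combination htrace
  have hpow : u ^ 8 = 1 ∨ u ^ 12 = 1 := by
    interval_cases m <;> push_cast at hpoly
    · right
      have h : u ^ 2 + 1 = 0 := pow_eq_zero_iff two_ne_zero |>.mp (by linear_combination hpoly)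
      linear_combination (u ^ 10 - u ^ 8 + u ^ 6 - u ^ 4 + u ^ 2 - 1) * h
    · right
      linear_combination (u ^ 6 + 1) * (u ^ 2 - 1) * hpoly
    · left
      linear_combination (u ^ 4 - 1) * hpoly
    · right
      linear_combination (u ^ 6 - 1) * (u ^ 2 + 1) * hpoly
    · right
      have h : u ^ 2 - 1 = 0 := pow_eq_zero_iff two_ne_zero |>.mp (by linear_combination hpoly)
      linear_combination (u ^ 10 + u ^ 8 + u ^ 6 + u ^ 4 + u ^ 2 + 1) * h
  have hord : n = orderOf u :=
    le_antisymm (hleast _ (orderOf_pos_iff.mpr (isOfFinOrder_iff_pow_eq_one.mpr ⟨n, hn, hroot⟩))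
      (pow_orderOf_eq_one u)) (orderOf_le_of_pow_eq_one hn hroot)
  have hdvd : n ∣ 8 ∨ n ∣ 12 :=
    hord ▸ hpow.imp orderOf_dvd_of_pow_eq_one orderOf_dvd_of_pow_eq_one
  have hn12 : n ≤ 12 := by
    rcases hdvd with h | h
    · exact (Nat.le_of_dvd (by norm_num) h).trans (by norm_num)
    · exact Nat.le_of_dvd (by norm_num) h
  clear hord hroot hleast htrace
  revert hdvd
  interval_cases n <;> norm_num
end

section
/- Let u ∈ 𝕊¹ be not a root of unity. Then for every continuous function f : ℝ → ℂ, the averages (1/n) ∑_{r=1}^n f(u^r + conj(u)^r) = (1/n) ∑_{r=1}^n f(2·Re(u^r)) converge, as n → ∞, to ∫_{−2}^{2} f(x)/(π·√(4 − x²)) dx. (This says the normalized Frobenius traces of an ordinary elliptic curve are equidistributed on [−2, 2] with respect to the measure λ₁(x) = dx/(π√(4 − x²)), the pushforward of the Haar measure on 𝕊¹ under z ↦ z + conj(z).) -/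
open Filter Topology MeasureTheory

/-- The partial sums `z + z² + ⋯ + zⁿ` are bounded by `2 / ‖z - 1‖` for unimodular `z ≠ 1`. -/
lemma norm_sum_Icc_pow_le {z : ℂ} (hz : ‖z‖ = 1) (hz1 : z ≠ 1) (n : ℕ) :
    ‖∑ r ∈ Finset.Icc 1 n, z ^ r‖ ≤ 2 / ‖z - 1‖ := by
  have key : (∑ r ∈ Finset.Icc 1 n, z ^ r) * (z - 1) = z ^ (n + 1) - z := by
    induction n with
    | zero => simp
    | succ n ih =>
      rw [Finset.sum_Icc_succ_top (by omega), add_mul, ih]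
      ring
  rw [le_div_iff₀ (norm_pos_iff.2 (sub_ne_zero.2 hz1)), ← norm_mul, key]
  refine (norm_sub_le _ _).trans ?_
  rw [norm_pow, hz]
  norm_num

/-- The averages of the powers of a unimodular `z ≠ 1` tend to zero. -/
lemma tendsto_average_pow_zero {z : ℂ} (hz : ‖z‖ = 1) (hz1 : z ≠ 1) :
    Tendsto (fun n : ℕ => (n : ℂ)⁻¹ • ∑ r ∈ Finset.Icc 1 n, z ^ r) atTop (𝓝 0) := by
  refine squeeze_zero_norm (a := fun n : ℕ => 2 / ‖z - 1‖ / (n : ℝ)) (fun n => ?_)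
    (tendsto_const_div_atTop_nhds_zero_nat _)
  rw [norm_smul, norm_inv, Complex.norm_natCast, div_eq_inv_mul _ (n : ℝ)]
  exact mul_le_mul_of_nonneg_left (norm_sum_Icc_pow_le hz hz1 n) (by positivity)

/-- Averages along an orbit are bounded by the supremum norm. -/
lemma norm_average_le {X : Type*} [TopologicalSpace X] [CompactSpace X] (g : C(X, ℂ))
    (x : ℕ → X) (n : ℕ) : ‖(n : ℂ)⁻¹ • ∑ r ∈ Finset.Icc 1 n, g (x r)‖ ≤ ‖g‖ := by
  rw [norm_smul, norm_inv, Complex.norm_natCast]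
  have h : ‖∑ r ∈ Finset.Icc 1 n, g (x r)‖ ≤ n * ‖g‖ := by
    refine (norm_sum_le_of_le _ (fun r _ => g.norm_coe_le_norm (x r))).trans ?_
    simp
  rcases Nat.eq_zero_or_pos n with rfl | hn
  · simp
  · have hn' : (0 : ℝ) < n := by exact_mod_cast hn
    rw [inv_mul_le_iff₀ hn']
    exact h

/-- **Weyl equidistribution** on the circle `ℝ / Tℤ`, for an element of infinite order. -/
theorem tendsto_average_nsmul_addCircle {T : ℝ} [hT : Fact (0 < T)] (x : AddCircle T)
    (hx : ∀ n : ℕ, 1 ≤ n → n • x ≠ 0) (g : C(AddCircle T, ℂ)) :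
    Tendsto (fun n : ℕ => (n : ℂ)⁻¹ • ∑ r ∈ Finset.Icc 1 n, g (r • x)) atTop
      (𝓝 (∫ t, g t ∂AddCircle.haarAddCircle)) := by
  have hint : ∀ g : C(AddCircle T, ℂ), Integrable g AddCircle.haarAddCircle := fun g =>
    g.continuous.integrable_of_hasCompactSupport (HasCompactSupport.of_compactSpace g)
  have hclosed : IsClosed {g : C(AddCircle T, ℂ) |
      Tendsto (fun n : ℕ => (n : ℂ)⁻¹ • ∑ r ∈ Finset.Icc 1 n, g (r • x)) atTop
        (𝓝 (∫ t, g t ∂AddCircle.haarAddCircle))} := by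
    refine Equicontinuous.isClosed_setOfPred_tendsto
      (LipschitzWith.uniformEquicontinuous _ 1 fun n => ?_).equicontinuous
      (LipschitzWith.of_dist_le_mul (K := 1) fun g h => ?_).continuous
    · refine LipschitzWith.of_dist_le_mul fun g h => ?_
      rw [dist_eq_norm, dist_eq_norm, ← smul_sub, ← Finset.sum_sub_distrib, NNReal.coe_one,
        one_mul]
      exact norm_average_le (g - h) (fun r => r • x) n
    · rw [dist_eq_norm, dist_eq_norm, ← integral_sub (hint g) (hint h), NNReal.coe_one, one_mul]
      simpa using norm_integral_le_of_norm_le_const (μ := AddCircle.haarAddCircle (T := T))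
        (Eventually.of_forall fun t => (g - h).norm_coe_le_norm t)
  have hspan : ∀ g ∈ Submodule.span ℂ (Set.range (@fourier T)),
      Tendsto (fun n : ℕ => (n : ℂ)⁻¹ • ∑ r ∈ Finset.Icc 1 n, g (r • x)) atTop
        (𝓝 (∫ t, g t ∂AddCircle.haarAddCircle)) := by
    intro g hg
    induction hg using Submodule.span_induction with
    | mem g hg =>
      obtain ⟨k, rfl⟩ := hg
      have hI : ∫ t : AddCircle T, fourier k t ∂AddCircle.haarAddCircle = (Pi.single k 1 : ℤ → ℂ) 0 := by
        rw [← fourierCoeff_fourier (T := T) k]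
        simp [fourierCoeff]
      have hpow : ∀ r : ℕ, fourier k (r • x) = fourier k x ^ r := fun r => by
        rw [fourier_apply, fourier_apply, smul_comm, AddCircle.toCircle_nsmul, Circle.coe_pow]
      rw [hI]
      simp_rw [hpow]
      by_cases hk : k = 0
      · subst hk
        refine tendsto_const_nhds.congr' ?_
        filter_upwards [eventually_ge_atTop 1] with n hn
        have : (n : ℂ) ≠ 0 := by exact_mod_cast (by omega : n ≠ 0)
        simp [this]
      · rw [Pi.single_eq_of_ne (Ne.symm hk)]
        refine tendsto_average_pow_zero (Circle.norm_coe (k • x).toCircle) fun h => ?_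
        rw [fourier_apply, Circle.coe_eq_one, ← AddCircle.toCircle_zero (T := T)] at h
        have h0 : k • x = 0 := AddCircle.injective_toCircle hT.out.ne' h
        refine hx k.natAbs (by omega) ?_
        rcases Int.natAbs_eq k with h' | h' <;> rw [h'] at h0 <;> simpa using h0
    | zero => simp
    | add g h _ _ hg hh =>
      simp only [ContinuousMap.add_apply, Finset.sum_add_distrib, smul_add]
      rw [integral_add (hint g) (hint h)]
      exact hg.add hh
    | smul c g _ hg =>
      simp only [ContinuousMap.smul_apply, ← Finset.smul_sum]
      rw [integral_smul]
      simp_rw [smul_comm _ c]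
      exact hg.const_smul c
  have hmem : g ∈ (Submodule.span ℂ (Set.range (@fourier T))).topologicalClosure := by
    rw [span_fourier_closure_eq_top]
    trivial
  exact closure_minimal hspan hclosed hmem

/-- The substitution `x = 2 cos t` in integrals against the arcsine density on `[-2, 2]`. -/
lemma integral_arcsine_eq_integral_cos (f : ℝ → ℂ) :
    ∫ x in Set.Icc (-2 : ℝ) 2, f x / ((Real.pi * Real.sqrt (4 - x ^ 2) : ℝ) : ℂ) =
      (Real.pi : ℂ)⁻¹ * ∫ t in (0 : ℝ)..Real.pi, f (2 * Real.cos t) := by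
  have himg : (fun t => 2 * Real.cos t) '' Set.Icc 0 Real.pi = Set.Icc (-2) 2 := by
    ext y
    constructor
    · rintro ⟨t, -, rfl⟩
      constructor <;> dsimp only <;> linarith [Real.neg_one_le_cos t, Real.cos_le_one t]
    · rintro ⟨h1, h2⟩
      refine ⟨Real.arccos (y / 2), ⟨Real.arccos_nonneg _, Real.arccos_le_pi _⟩, ?_⟩
      dsimp only
      rw [Real.cos_arccos (by linarith) (by linarith)]
      ring
  rw [← himg, integral_image_eq_integral_abs_deriv_smul measurableSet_Icc
    (f' := fun t => 2 * -Real.sin t)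
    (fun t _ => ((Real.hasDerivAt_cos t).const_mul 2).hasDerivWithinAt)
    (fun s hs t ht h => Real.injOn_cos hs ht (by linarith)),
    integral_Icc_eq_integral_Ioo, intervalIntegral.integral_of_le Real.pi_pos.le,
    integral_Ioc_eq_integral_Ioo, ← integral_const_mul]
  refine setIntegral_congr_fun measurableSet_Ioo fun t ht => ?_
  have hs := Real.sin_pos_of_pos_of_lt_pi ht.1 ht.2
  have hsqrt : Real.sqrt (4 - (2 * Real.cos t) ^ 2) = 2 * Real.sin t := by
    rw [← Real.sqrt_sq (by positivity : 0 ≤ 2 * Real.sin t)]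
    congr 1
    linarith [Real.sin_sq_add_cos_sq t]
  have habs : |2 * -Real.sin t| = 2 * Real.sin t := by
    rw [mul_neg, abs_neg, abs_of_pos (by positivity)]
  have hs' : (Real.sin t : ℂ) ≠ 0 := by exact_mod_cast hs.ne'
  have hpi : (Real.pi : ℂ) ≠ 0 := by exact_mod_cast Real.pi_ne_zero
  simp only [hsqrt, habs, Complex.real_smul]
  push_cast at hs' ⊢
  field_simp

/-- The Haar average of a function of `2 Re z` over the unit circle, as an integral against the
arcsine density. -/
lemma integral_haarAddCircle_cos [Fact (0 < 2 * Real.pi)] {f : ℝ → ℂ} (hf : Continuous f) :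
    ∫ t : AddCircle (2 * Real.pi), f (2 * (AddCircle.toCircle t : ℂ).re)
        ∂AddCircle.haarAddCircle =
      ∫ x in Set.Icc (-2 : ℝ) 2, f x / ((Real.pi * Real.sqrt (4 - x ^ 2) : ℝ) : ℂ) := by
  have hre : ∀ t : ℝ, (AddCircle.toCircle (t : AddCircle (2 * Real.pi)) : ℂ).re = Real.cos t := by
    intro t
    rw [AddCircle.toCircle_apply_mk, div_self (by positivity), one_mul, Circle.coe_exp,
      Complex.exp_ofReal_mul_I_re]
  have hc : Continuous fun t => f (2 * Real.cos t) := by fun_prop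
  have hneg : ∫ t in (-Real.pi)..0, f (2 * Real.cos t) =
      ∫ t in (0 : ℝ)..Real.pi, f (2 * Real.cos t) := by
    have := intervalIntegral.integral_comp_neg (a := 0) (b := Real.pi)
      (fun t => f (2 * Real.cos t))
    simpa using this.symm
  rw [integral_arcsine_eq_integral_cos, AddCircle.integral_haarAddCircle,
    ← AddCircle.intervalIntegral_preimage _ (-Real.pi)]
  simp_rw [hre]
  rw [show -Real.pi + 2 * Real.pi = Real.pi by ring,
    ← intervalIntegral.integral_add_adjacent_intervals (b := 0)
      (hc.intervalIntegrable _ _) (hc.intervalIntegrable _ _), hneg, Complex.real_smul]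
  push_cast
  ring

/-- **Equidistribution of normalized Frobenius traces of ordinary elliptic curves.**
Let `u ∈ 𝕊¹` be not a root of unity.  For every continuous `f : ℝ → ℂ` the averages
`(1/n) ∑_{r=1}^n f (2·Re(u^r))` converge to `∫_{-2}^{2} f x / (π √(4 - x²)) dx`. -/
theorem ordinary_trace_equidistribution (u : Circle) (hu : ∀ n : ℕ, 1 ≤ n → u ^ n ≠ 1) :
    ∀ f : ℝ → ℂ, Continuous f →
      Tendsto (fun n : ℕ => (n : ℂ)⁻¹ • ∑ r ∈ Finset.Icc 1 n, f (2 * ((u : ℂ) ^ r).re)) atTop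
        (𝓝 (∫ x in Set.Icc (-2 : ℝ) 2,
              f x / ((Real.pi * Real.sqrt (4 - x ^ 2) : ℝ) : ℂ))) := by
  intro f hf
  have : Fact (0 < 2 * Real.pi) := ⟨by positivity⟩
  obtain ⟨x, rfl⟩ : ∃ x : AddCircle (2 * Real.pi), AddCircle.toCircle x = u := by
    obtain ⟨x, hx⟩ := (AddCircle.homeomorphCircle (T := 2 * Real.pi) (by positivity)).surjective u
    exact ⟨x, by rw [← hx, AddCircle.homeomorphCircle_apply]⟩
  have hg : Continuous fun t : AddCircle (2 * Real.pi) =>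
      f (2 * (AddCircle.toCircle t : ℂ).re) := by
    have := AddCircle.continuous_toCircle (T := 2 * Real.pi)
    fun_prop
  have h := tendsto_average_nsmul_addCircle x
    (fun n hn h => hu n hn (by rw [← AddCircle.toCircle_nsmul, h, AddCircle.toCircle_zero]))
    ⟨_, hg⟩
  simp only [ContinuousMap.coe_mk, AddCircle.toCircle_nsmul, Circle.coe_pow] at h
  rwa [integral_haarAddCircle_cos hf] at h
end

section
/- Let u ∈ 𝕊¹ be not a root of unity, and for each integer r ≥ 1 set x_r = u^r + conj(u)^r + (−u)^r + (−conj(u))^r = (1 + (−1)^r)·2·Re(u^r) ∈ [−4, 4] (so x_r = 0 for odd r and x_r = 4·Re(u^r) for even r). Then for every continuous function f : ℝ → ℂ, the averages (1/n) ∑_{r=1}^n f(x_r) converge, as n → ∞, to (1/2)·f(0) + ∫_{−4}^{4} f(x)/(2π·√(16 − x²)) dx. (This is the trace distribution (1/2)δ₀ + dx/(2π√(16 − x²)) of a simple ordinary abelian surface that splits over a quadratic extension as the square of an elliptic curve.) -/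
open Filter Topology MeasureTheory

/-- The integral of a nontrivial Fourier monomial over the additive circle vanishes. -/
theorem integral_fourier_of_ne_zero {T : ℝ} [hT : Fact (0 < T)] {n : ℤ} (hn : n ≠ 0) :
    ∫ t : AddCircle T, fourier n t ∂AddCircle.haarAddCircle = 0 :=
  integral_eq_zero_of_add_right_eq_neg (μ := AddCircle.haarAddCircle)
    (fourier_add_half_inv_index hn hT.elim)

/-- Averages of the powers of a complex number `w ≠ 1` of norm one tend to zero. -/
theorem tendsto_average_pow_of_norm_eq_one {w : ℂ} (hw : ‖w‖ = 1) (hw1 : w ≠ 1) :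
    Tendsto (fun n : ℕ => (n : ℂ)⁻¹ * ∑ k ∈ Finset.range n, w ^ k) atTop (𝓝 0) := by
  have hlim : Tendsto (fun n : ℕ => 2 / ‖w - 1‖ / (n : ℝ)) atTop (𝓝 0) :=
    tendsto_const_nhds.div_atTop tendsto_natCast_atTop_atTop
  refine squeeze_zero_norm (fun n => ?_) hlim
  rw [geom_sum_eq hw1, norm_mul, norm_div, norm_inv, Complex.norm_natCast, div_eq_inv_mul _ (n : ℝ)]
  gcongr
  calc ‖w ^ n - 1‖ ≤ ‖w ^ n‖ + ‖(1 : ℂ)‖ := norm_sub_le _ _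
    _ = 2 := by rw [norm_pow, hw]; norm_num

/-- **Weyl equidistribution**: the orbit of a point under translation by an element of infinite
order of the additive circle is equidistributed. -/
theorem AddCircle.tendsto_average_add_nsmul {T : ℝ} [hT : Fact (0 < T)] (a y : AddCircle T)
    (hy : ∀ n : ℕ, 1 ≤ n → n • y ≠ 0) (F : C(AddCircle T, ℂ)) :
    Tendsto (fun n : ℕ => (n : ℂ)⁻¹ * ∑ k ∈ Finset.range n, F (a + k • y)) atTop
      (𝓝 (∫ t, F t ∂AddCircle.haarAddCircle)) := by
  have hint (G : C(AddCircle T, ℂ)) : Integrable G (AddCircle.haarAddCircle (T := T)) :=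
    G.continuous.integrable_of_hasCompactSupport (HasCompactSupport.of_compactSpace _)
  let τ : C(AddCircle T, ℂ) → C(AddCircle T, ℂ) := fun G => G.comp (ContinuousMap.addRight y)
  have hτ (k : ℕ) (G : C(AddCircle T, ℂ)) : (τ^[k] G) a = G (a + k • y) := by
    induction k generalizing G with
    | zero => simp
    | succ k ih =>
      rw [Function.iterate_succ_apply, ih]
      simp [τ, succ_nsmul, add_assoc]
  have havg (G : C(AddCircle T, ℂ)) (n : ℕ) :
      birkhoffAverage ℂ τ (fun H => H a) n G =
        (n : ℂ)⁻¹ * ∑ k ∈ Finset.range n, G (a + k • y) := by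
    simp [birkhoffAverage, birkhoffSum, hτ]
  have hclosed : IsClosed {G : C(AddCircle T, ℂ) |
      Tendsto (fun n : ℕ => (n : ℂ)⁻¹ * ∑ k ∈ Finset.range n, G (a + k • y)) atTop
        (𝓝 (∫ t, G t ∂AddCircle.haarAddCircle))} := by
    simp only [← havg]
    refine isClosed_setOfPred_tendsto_birkhoffAverage ℂ ?_ ?_ ?_
    · refine LipschitzWith.of_dist_le_mul fun G H => ?_
      rw [NNReal.coe_one, one_mul]
      exact (ContinuousMap.dist_le dist_nonneg).2 fun x =>
        ContinuousMap.dist_apply_le_dist (f := G) (g := H) (x + y)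
    · refine (LipschitzWith.of_dist_le_mul (K := 1) fun G H => ?_).uniformContinuous
      rw [NNReal.coe_one, one_mul]
      exact ContinuousMap.dist_apply_le_dist (f := G) (g := H) a
    · refine (LipschitzWith.of_dist_le_mul (K := 1) fun G H => ?_).continuous
      rw [dist_eq_norm, ← integral_sub (hint G) (hint H), NNReal.coe_one, one_mul]
      refine (norm_integral_le_of_norm_le_const (C := dist G H) (ae_of_all _ fun t => ?_)).trans ?_
      · rw [← dist_eq_norm]
        exact ContinuousMap.dist_apply_le_dist _
      · simp
  have hmem : F ∈ closure (Submodule.span ℂ (Set.range (fourier (T := T))) :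
      Set C(AddCircle T, ℂ)) := by
    rw [← Submodule.topologicalClosure_coe, span_fourier_closure_eq_top]
    trivial
  refine closure_minimal (fun G hG => ?_) hclosed hmem
  induction hG using Submodule.span_induction with
  | mem G hG =>
    obtain ⟨m, rfl⟩ := hG
    rcases eq_or_ne m 0 with rfl | hm
    · refine tendsto_const_nhds.congr' ?_
      filter_upwards [eventually_ne_atTop 0] with n hn
      simp [hn]
    · have hw1 : (fourier m y : ℂ) ≠ 1 := by
        intro h
        rw [fourier_apply, Circle.coe_eq_one, ← AddCircle.toCircle_zero (T := T)] at h
        have h0 : m • y = 0 := AddCircle.injective_toCircle hT.out.ne' h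
        refine hy m.natAbs (Int.natAbs_pos.2 hm) ?_
        rcases Int.natAbs_eq m with h1 | h1 <;> rw [h1] at h0 <;> simpa using h0
      have hpow (k : ℕ) : (fourier m (a + k • y) : ℂ) = fourier m a * fourier m y ^ k := by
        simp only [fourier_apply, smul_add, AddCircle.toCircle_add, Circle.coe_mul,
          smul_comm m k y, AddCircle.toCircle_nsmul, Circle.coe_pow]
      have h := (tendsto_average_pow_of_norm_eq_one
        (by rw [fourier_apply]; exact Circle.norm_coe _) hw1).const_mul (fourier m a : ℂ)
      simp only [Set.mem_ofPred_eq, hpow, integral_fourier_of_ne_zero hm, ← Finset.mul_sum]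
      rw [mul_zero] at h
      exact h.congr fun n => by ring
  | zero => simp
  | add G H _ _ hG hH =>
    have h := hG.add hH
    rw [← integral_add (hint G) (hint H)] at h
    simpa [Finset.sum_add_distrib, mul_add] using h
  | smul c G _ hG =>
    have h := hG.const_mul c
    rw [← integral_const_mul] at h
    simpa [← Finset.mul_sum, mul_left_comm] using h

/-- The integral of a function against the arcsine density on `[-4, 4]`, in terms of `θ` with
`x = 4 cos θ`. -/
theorem integral_Icc_div_sqrt_eq_integral_cos (f : ℝ → ℂ) :
    ∫ x in Set.Icc (-4 : ℝ) 4, f x / ((2 * Real.pi * Real.sqrt (16 - x ^ 2) : ℝ) : ℂ) =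
      ((2 * Real.pi : ℝ) : ℂ)⁻¹ * ∫ θ in (0 : ℝ)..Real.pi, f (4 * Real.cos θ) := by
  have himage : (fun θ => 4 * Real.cos θ) '' Set.Ioo 0 Real.pi = Set.Ioo (-4) 4 := by
    ext x
    constructor
    · rintro ⟨θ, hθ, rfl⟩
      have h := Real.mapsTo_cos_Ioo hθ
      constructor <;> [linarith [h.1]; linarith [h.2]]
    · intro hx
      refine ⟨Real.arccos (x / 4), ⟨Real.arccos_pos.2 (by linarith [hx.2]), ?_⟩, ?_⟩
      · rw [lt_iff_le_and_ne, Ne, Real.arccos_eq_pi, not_le]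
        exact ⟨Real.arccos_le_pi _, by linarith [hx.1]⟩
      · simp only []
        rw [Real.cos_arccos (by linarith [hx.1]) (by linarith [hx.2])]
        ring
  rw [integral_Icc_eq_integral_Ioo, ← himage,
    integral_image_eq_integral_abs_deriv_smul (f' := fun θ => 4 * -Real.sin θ) measurableSet_Ioo
      (fun θ _ => ((Real.hasDerivAt_cos θ).const_mul 4).hasDerivWithinAt)
      (fun x hx z hz h => Real.injOn_cos (Set.Ioo_subset_Icc_self hx) (Set.Ioo_subset_Icc_self hz)
        (mul_left_cancel₀ four_ne_zero h)),
    intervalIntegral.integral_of_le Real.pi_pos.le, integral_Ioc_eq_integral_Ioo,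
    ← integral_const_mul]
  refine setIntegral_congr_fun measurableSet_Ioo fun θ hθ => ?_
  have hsin : 0 < Real.sin θ := Real.sin_pos_of_mem_Ioo hθ
  have hsqrt : Real.sqrt (16 - (4 * Real.cos θ) ^ 2) = 4 * Real.sin θ := by
    rw [show 16 - (4 * Real.cos θ) ^ 2 = (4 * Real.sin θ) ^ 2 by
      nlinarith [Real.sin_sq_add_cos_sq θ], Real.sqrt_sq (by positivity)]
  have habs : |4 * -Real.sin θ| = 4 * Real.sin θ := by
    rw [mul_neg, abs_neg, abs_of_pos (by positivity)]
  have hsinC : (Real.sin θ : ℂ) ≠ 0 := by exact_mod_cast hsin.ne'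
  have hpiC : (Real.pi : ℂ) ≠ 0 := by exact_mod_cast Real.pi_ne_zero
  simp only [hsqrt, habs, Complex.real_smul]
  push_cast [-Complex.ofReal_sin]
  field_simp

/-- The Haar integral of an even function of the angle, on the circle of length `2π`. -/
theorem integral_haarAddCircle_toCircle_re [Fact (0 < 2 * Real.pi)] {f : ℝ → ℂ}
    (hf : Continuous f) :
    ∫ t : AddCircle (2 * Real.pi), f (4 * (t.toCircle : ℂ).re) ∂AddCircle.haarAddCircle =
      (Real.pi : ℂ)⁻¹ * ∫ θ in (0 : ℝ)..Real.pi, f (4 * Real.cos θ) := by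
  have hcos (θ : ℝ) : (AddCircle.toCircle (θ : AddCircle (2 * Real.pi)) : ℂ).re = Real.cos θ := by
    rw [AddCircle.toCircle_apply_mk, div_self Real.two_pi_pos.ne', one_mul, Circle.coe_exp,
      Complex.exp_ofReal_mul_I_re]
  have hg : Continuous fun θ : ℝ => f (4 * Real.cos θ) := by fun_prop
  rw [AddCircle.integral_haarAddCircle, ← AddCircle.intervalIntegral_preimage _ (-Real.pi)]
  simp only [hcos]
  rw [show -Real.pi + 2 * Real.pi = Real.pi by ring,
    ← intervalIntegral.integral_add_adjacent_intervals (hg.intervalIntegrable _ 0)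
      (hg.intervalIntegrable 0 _)]
  have hneg : ∫ θ in (-Real.pi)..0, f (4 * Real.cos θ) = ∫ θ in (0 : ℝ)..Real.pi,
      f (4 * Real.cos θ) := by
    simpa using (intervalIntegral.integral_comp_neg (a := 0) (b := Real.pi)
      fun θ => f (4 * Real.cos θ)).symm
  rw [hneg, Complex.real_smul, ← two_mul]
  have hpiC : (Real.pi : ℂ) ≠ 0 := by exact_mod_cast Real.pi_ne_zero
  push_cast
  field_simp

/-- The proportion of even numbers among `1, …, n` tends to one half. -/
theorem tendsto_natCast_div_two_div_self :
    Tendsto (fun n : ℕ => ((n / 2 : ℕ) : ℂ) / n) atTop (𝓝 (1 / 2)) := by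
  have h : Tendsto (fun n : ℕ => ((⌊(1 / 2 : ℝ) * n⌋₊ : ℝ)) / n) atTop (𝓝 (1 / 2)) :=
    (tendsto_nat_floor_mul_div_atTop (by norm_num : (0 : ℝ) ≤ 1 / 2)).comp
      tendsto_natCast_atTop_atTop
  have h' := (Complex.continuous_ofReal.tendsto _).comp h
  convert h' using 2 with n
  · have : ⌊(1 / 2 : ℝ) * n⌋₊ = n / 2 := by
      rw [one_div, inv_mul_eq_div]
      exact_mod_cast Nat.floor_div_eq_div n 2
    simp only [Function.comp_apply, this]
    push_cast
    rfl
  · push_cast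
    rfl

/-- A sum over `1, …, n` of terms equal to `c` at odd indices, split by parity. -/
theorem sum_Icc_eq_of_odd_eq_const {g : ℕ → ℂ} {c : ℂ} (hodd : ∀ k, g (2 * k + 1) = c) (n : ℕ) :
    ∑ r ∈ Finset.Icc 1 n, g r =
      ∑ k ∈ Finset.range (n / 2), g (2 * (k + 1)) + ((n : ℂ) - (n / 2 : ℕ)) * c := by
  induction n with
  | zero => simp
  | succ n ih =>
    rw [Finset.sum_Icc_succ_top (by lia), ih]
    rcases Nat.even_or_odd' n with ⟨m, rfl | rfl⟩
    · rw [show (2 * m + 1) / 2 = m by lia, show 2 * m / 2 = m by lia, hodd]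
      push_cast
      ring
    · rw [show (2 * m + 1 + 1) / 2 = m + 1 by lia, show (2 * m + 1) / 2 = m by lia,
        Finset.sum_range_succ, show 2 * m + 1 + 1 = 2 * (m + 1) by ring]
      push_cast
      ring

/-- **Trace distribution of a simple ordinary abelian surface splitting over a quadratic
extension as the square of an elliptic curve.**
Let `u ∈ 𝕊¹` be not a root of unity and set `x_r = (1 + (-1)^r)·2·Re(u^r) ∈ [-4, 4]`.
For every continuous `f : ℝ → ℂ` the averages `(1/n) ∑_{r=1}^n f (x_r)` converge to
`(1/2)·f(0) + ∫_{-4}^{4} f x / (2π √(16 - x²)) dx`. -/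
theorem split_surface_trace_equidistribution (u : Circle)
    (hu : ∀ n : ℕ, 1 ≤ n → u ^ n ≠ 1) :
    ∀ f : ℝ → ℂ, Continuous f →
      Tendsto
        (fun n : ℕ => (n : ℂ)⁻¹ •
          ∑ r ∈ Finset.Icc 1 n, f ((1 + (-1 : ℝ) ^ r) * (2 * ((u : ℂ) ^ r).re))) atTop
        (𝓝 ((1 / 2 : ℂ) * f 0 +
          ∫ x in Set.Icc (-4 : ℝ) 4,
            f x / ((2 * Real.pi * Real.sqrt (16 - x ^ 2) : ℝ) : ℂ))) := by
  intro f hf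
  have : Fact (0 < 2 * Real.pi) := ⟨Real.two_pi_pos⟩
  obtain ⟨y, hyu⟩ : ∃ y : AddCircle (2 * Real.pi), y.toCircle = u ^ 2 :=
    by
    simpa only [AddCircle.homeomorphCircle_apply] using
      (AddCircle.homeomorphCircle Real.two_pi_pos.ne').surjective (u ^ 2)
  have hy (n : ℕ) (hn : 1 ≤ n) : n • y ≠ 0 := by
    intro h
    refine hu (2 * n) (by lia) ?_
    rw [pow_mul, ← hyu, ← AddCircle.toCircle_nsmul, h, AddCircle.toCircle_zero]
  let F : C(AddCircle (2 * Real.pi), ℂ) :=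
    ⟨fun t => f (4 * (t.toCircle : ℂ).re), hf.comp <| continuous_const.mul <|
      Complex.continuous_re.comp <| continuous_subtype_val.comp AddCircle.continuous_toCircle⟩
  have heven (k : ℕ) :
      f ((1 + (-1 : ℝ) ^ (2 * (k + 1))) * (2 * ((u : ℂ) ^ (2 * (k + 1))).re)) =
        F (y + k • y) := by
    have hz : ((y + k • y).toCircle : ℂ) = (u : ℂ) ^ (2 * (k + 1)) := by
      rw [← succ_nsmul', AddCircle.toCircle_nsmul, hyu, ← pow_mul, Circle.coe_pow]
    simp only [F, ContinuousMap.coe_mk, hz, pow_mul, neg_one_sq, one_pow]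
    ring_nf
  have hsum := sum_Icc_eq_of_odd_eq_const (c := f 0)
    (g := fun r => f ((1 + (-1 : ℝ) ^ r) * (2 * ((u : ℂ) ^ r).re)))
    (fun k => by simp [pow_succ, pow_mul])
  have hweyl := (AddCircle.tendsto_average_add_nsmul y y hy F).comp
    (Nat.tendsto_div_const_atTop two_ne_zero)
  have hhalf := tendsto_natCast_div_two_div_self
  have hlim := (hhalf.mul hweyl).add
    ((tendsto_const_nhds (x := (1 : ℂ))).sub hhalf |>.mul_const (f 0))
  have hF : ∫ t, F t ∂AddCircle.haarAddCircle = _ := integral_haarAddCircle_toCircle_re hf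
  rw [hF] at hlim
  rw [integral_Icc_div_sqrt_eq_integral_cos]
  convert hlim.congr' ?_ using 2
  · push_cast
    rw [mul_inv]
    ring
  · filter_upwards [eventually_ge_atTop 2] with n hn
    have hn0 : (n : ℂ) ≠ 0 := by exact_mod_cast (by lia : n ≠ 0)
    have hm0 : ((n / 2 : ℕ) : ℂ) ≠ 0 := by exact_mod_cast (by lia : n / 2 ≠ 0)
    rw [hsum n, smul_eq_mul]
    simp only [heven, Function.comp_apply]
    generalize ((n / 2 : ℕ) : ℂ) = m at *
    field_simp
end

section
/- Let u ∈ 𝕊¹ be not a root of unity and let ζ ∈ 𝕊¹ be a root of unity of order m ≥ 1. Then the topological closure of the subgroup of (𝕊¹)² generated by the pair (u, ζ·u) equals the set {(w, ζ^k·w) : w ∈ 𝕊¹, k ∈ ℤ}, and the topological closure of the subgroup generated by (u, ζ·u⁻¹) equals {(w, ζ^k·w⁻¹) : w ∈ 𝕊¹, k ∈ ℤ}; in both cases this closure is isomorphic as a topological group to 𝕊¹ × ℤ/mℤ. -/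
/-- The homomorphism `ℤ/mℤ → G`, `k ↦ ζ ^ k`, attached to an element `ζ` with `ζ ^ m = 1`. -/
def zmodPowHom {G : Type*} [Group G] (m : ℕ) (ζ : G) (h : ζ ^ m = 1) :
    Multiplicative (ZMod m) →* G :=
  AddMonoidHom.toMultiplicativeLeft
    (ZMod.lift m ⟨(zpowersHom G ζ).toAdditiveRight, by simp [h]⟩)

theorem zmodPowHom_ofAdd_intCast {G : Type*} [Group G] (m : ℕ) (ζ : G) (h : ζ ^ m = 1) (k : ℤ) :
    zmodPowHom m ζ h (Multiplicative.ofAdd (k : ZMod m)) = ζ ^ k := by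
  simp [zmodPowHom]

theorem zmodPowHom_injective {G : Type*} [Group G] (m : ℕ) (ζ : G) (h : ζ ^ m = 1)
    (hζ : orderOf ζ = m) : Function.Injective (zmodPowHom m ζ h) := by
  rw [injective_iff_map_eq_one]
  intro a ha
  obtain ⟨k, hk⟩ := ZMod.intCast_surjective a.toAdd
  obtain rfl : a = Multiplicative.ofAdd (k : ZMod m) := by rw [hk]; rfl
  rw [zmodPowHom_ofAdd_intCast, ← orderOf_dvd_iff_zpow_eq_one, hζ] at ha
  rw [(ZMod.intCast_zmod_eq_zero_iff_dvd k m).2 ha, ofAdd_zero]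

/-- The homomorphism `(w, k) ↦ (w, ζ ^ k * σ w)`. -/
def twistedGraphHom {G K : Type*} [CommGroup G] [CommGroup K] (σ : G →* K) (m : ℕ) (ζ : K)
    (h : ζ ^ m = 1) : G × Multiplicative (ZMod m) →* G × K :=
  (MonoidHom.fst _ _).prod ((zmodPowHom m ζ h).comp (MonoidHom.snd _ _) *
    σ.comp (MonoidHom.fst _ _))

theorem twistedGraphHom_apply {G K : Type*} [CommGroup G] [CommGroup K] (σ : G →* K) (m : ℕ)
    (ζ : K) (h : ζ ^ m = 1) (x : G × Multiplicative (ZMod m)) :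
    twistedGraphHom σ m ζ h x = (x.1, zmodPowHom m ζ h x.2 * σ x.1) := rfl

theorem twistedGraphHom_injective {G K : Type*} [CommGroup G] [CommGroup K] (σ : G →* K) (m : ℕ)
    (ζ : K) (h : ζ ^ m = 1) (hζ : orderOf ζ = m) :
    Function.Injective (twistedGraphHom σ m ζ h) := by
  rintro ⟨w, a⟩ ⟨w', a'⟩ hw
  simp only [twistedGraphHom_apply, Prod.mk.injEq] at hw
  obtain ⟨rfl, hw⟩ := hw
  rw [zmodPowHom_injective m ζ h hζ (mul_right_cancel hw)]

theorem continuous_twistedGraphHom {G K : Type*} [CommGroup G] [CommGroup K] [TopologicalSpace G]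
    [TopologicalSpace K] [IsTopologicalGroup K] (σ : G →* K) (hσ : Continuous σ) (m : ℕ)
    (ζ : K) (h : ζ ^ m = 1) : Continuous (twistedGraphHom σ m ζ h) := by
  have : DiscreteTopology (Multiplicative (ZMod m)) := ⟨rfl⟩
  have hz : Continuous (zmodPowHom m ζ h) := continuous_of_discreteTopology
  exact continuous_fst.prodMk ((hz.comp continuous_snd).mul (hσ.comp continuous_fst))

theorem coe_range_twistedGraphHom {G K : Type*} [CommGroup G] [CommGroup K] (σ : G →* K) (m : ℕ)
    (ζ : K) (h : ζ ^ m = 1) :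
    ((twistedGraphHom σ m ζ h).range : Set (G × K)) =
      {p | ∃ w : G, ∃ k : ℤ, p = (w, ζ ^ k * σ w)} := by
  ext p
  constructor
  · rintro ⟨⟨w, a⟩, rfl⟩
    obtain ⟨k, hk⟩ := ZMod.intCast_surjective a.toAdd
    obtain rfl : a = Multiplicative.ofAdd (k : ZMod m) := by rw [hk]; rfl
    exact ⟨w, k, by rw [twistedGraphHom_apply, zmodPowHom_ofAdd_intCast]⟩
  · rintro ⟨w, k, rfl⟩
    exact ⟨(w, Multiplicative.ofAdd (k : ZMod m)), by
      rw [twistedGraphHom_apply, zmodPowHom_ofAdd_intCast]⟩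

theorem topologicalClosure_closure_singleton_eq_range {G K : Type*} [CommGroup G] [CommGroup K]
    [TopologicalSpace G] [TopologicalSpace K] [IsTopologicalGroup G] [IsTopologicalGroup K]
    [CompactSpace G] [T2Space G] [T2Space K] (σ : G →* K) (hσ : Continuous σ) (m : ℕ) [NeZero m]
    (ζ : K) (h : ζ ^ m = 1) (u : G) (hu : DenseRange fun n : ℤ ↦ (u ^ m) ^ n) :
    (Subgroup.closure {(u, ζ * σ u)} : Subgroup (G × K)).topologicalClosure =
      (twistedGraphHom σ m ζ h).range := by
  set C := (Subgroup.closure {(u, ζ * σ u)} : Subgroup (G × K)).topologicalClosure with hC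
  have huC : (u, ζ * σ u) ∈ C :=
    Subgroup.le_topologicalClosure _ (Subgroup.subset_closure rfl)
  apply le_antisymm
  · apply Subgroup.topologicalClosure_minimal
    · rw [Subgroup.closure_le, Set.singleton_subset_iff, coe_range_twistedGraphHom]
      exact ⟨u, 1, by rw [zpow_one]⟩
    · have : Finite (Multiplicative (ZMod m)) := inferInstanceAs (Finite (ZMod m))
      exact (isCompact_range (continuous_twistedGraphHom σ hσ m ζ h)).isClosed
  · have hgraph : ∀ w, (w, σ w) ∈ C := by
      have hclosed : IsClosed {w | (w, σ w) ∈ C} :=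
        (Subgroup.isClosed_topologicalClosure _).preimage (continuous_id.prodMk hσ)
      intro w
      refine hu.induction_on (p := fun w ↦ (w, σ w) ∈ C) w hclosed fun n ↦ ?_
      have := C.zpow_mem (C.pow_mem huC m) n
      simpa [Prod.pow_mk, mul_pow, h] using this
    have hζ : (1, ζ) ∈ C := by
      simpa using C.div_mem huC (hgraph u)
    intro p hp
    rw [← SetLike.mem_coe, coe_range_twistedGraphHom] at hp
    obtain ⟨w, k, rfl⟩ := hp
    simpa using C.mul_mem (C.zpow_mem hζ k) (hgraph w)

theorem exists_homeomorph_range_twistedGraphHom {G K : Type*} [CommGroup G] [CommGroup K]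
    [TopologicalSpace G] [TopologicalSpace K] [IsTopologicalGroup K]
    [CompactSpace G] [T2Space K] [T2Space G] (σ : G →* K) (hσ : Continuous σ) (m : ℕ) [NeZero m]
    (ζ : K) (h : ζ ^ m = 1) (hζ : orderOf ζ = m) :
    ∃ e : (twistedGraphHom σ m ζ h).range ≃ₜ (G × Multiplicative (ZMod m)),
      ∀ x y, e (x * y) = e x * e y := by
  have : Finite (Multiplicative (ZMod m)) := inferInstanceAs (Finite (ZMod m))
  let f := MonoidHom.ofInjective (twistedGraphHom_injective σ m ζ h hζ)
  have hf : Continuous f := (continuous_twistedGraphHom σ hσ m ζ h).subtype_mk _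
  exact ⟨(hf.homeoOfEquivCompactToT2 (f := f.toEquiv)).symm, f.symm.map_mul⟩

theorem Circle.denseRange_zpow {u : Circle} (hu : ∀ n : ℕ, 1 ≤ n → u ^ n ≠ 1) :
    DenseRange fun n : ℤ ↦ u ^ n := by
  let e := AddCircle.homeomorphCircle (one_ne_zero (α := ℝ))
  have he : ∀ (n : ℤ) (a : AddCircle (1 : ℝ)), e (n • a) = e a ^ n := fun n a ↦ by
    simp only [e, AddCircle.homeomorphCircle_apply, AddCircle.toCircle_zsmul]
  obtain ⟨a, rfl⟩ := e.surjective u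
  have ha : DenseRange fun n : ℤ ↦ n • a := by
    rw [AddCircle.denseRange_zsmul_iff, addOrderOf_eq_zero_iff']
    intro n hn h0
    refine hu n hn ?_
    rw [← zpow_natCast, ← he, natCast_zsmul, h0, AddCircle.homeomorphCircle_apply,
      AddCircle.toCircle_zero]
  simpa only [Function.comp_def, he] using e.surjective.denseRange.comp ha e.continuous

/-- **Serre–Frobenius group of a surface with eigenvalue relation `u₂ = ζ u₁` or
`u₂ = ζ u₁⁻¹`.**  Let `u ∈ 𝕊¹` be not a root of unity and `ζ ∈ 𝕊¹` a root of unity of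
order `m ≥ 1`.  The closure of the subgroup of `(𝕊¹)²` generated by `(u, ζu)` is
`{(w, ζ^k w)}`, the closure of the subgroup generated by `(u, ζu⁻¹)` is `{(w, ζ^k w⁻¹)}`,
and both are isomorphic as topological groups to `𝕊¹ × ℤ/mℤ`. -/
theorem closure_of_twisted_pair (u ζ : Circle) (hu : ∀ n : ℕ, 1 ≤ n → u ^ n ≠ 1)
    (m : ℕ) (hm : 1 ≤ m) (hζ : orderOf ζ = m) :
    (((Subgroup.closure {(u, ζ * u)} : Subgroup (Circle × Circle)).topologicalClosure :
        Set (Circle × Circle)) =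
      {p : Circle × Circle | ∃ w : Circle, ∃ k : ℤ, p = (w, ζ ^ k * w)}) ∧
    (((Subgroup.closure {(u, ζ * u⁻¹)} : Subgroup (Circle × Circle)).topologicalClosure :
        Set (Circle × Circle)) =
      {p : Circle × Circle | ∃ w : Circle, ∃ k : ℤ, p = (w, ζ ^ k * w⁻¹)}) ∧
    (∃ e : (Subgroup.closure {(u, ζ * u)} : Subgroup (Circle × Circle)).topologicalClosure ≃ₜ
        (Circle × Multiplicative (ZMod m)), ∀ x y, e (x * y) = e x * e y) ∧
    (∃ e : (Subgroup.closure {(u, ζ * u⁻¹)} : Subgroup (Circle × Circle)).topologicalClosure ≃ₜ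
        (Circle × Multiplicative (ZMod m)), ∀ x y, e (x * y) = e x * e y) := by
  have : NeZero m := ⟨by omega⟩
  have h : ζ ^ m = 1 := hζ ▸ pow_orderOf_eq_one ζ
  have hd : DenseRange fun n : ℤ ↦ (u ^ m) ^ n :=
    Circle.denseRange_zpow fun n hn ↦ by
      rw [← pow_mul]
      exact hu _ (Nat.mul_pos hm hn)
  have hid : Continuous (MonoidHom.id Circle) := continuous_id
  have hinv : Continuous (invMonoidHom : Circle →* Circle) := continuous_inv
  have key₁ := topologicalClosure_closure_singleton_eq_range _ hid m ζ h u hd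
  have key₂ := topologicalClosure_closure_singleton_eq_range _ hinv m ζ h u hd
  simp only [MonoidHom.id_apply, invMonoidHom_apply] at key₁ key₂
  rw [key₁, key₂]
  exact ⟨coe_range_twistedGraphHom _ m ζ h, coe_range_twistedGraphHom _ m ζ h,
    exists_homeomorph_range_twistedGraphHom _ hid m ζ h hζ,
    exists_homeomorph_range_twistedGraphHom _ hinv m ζ h hζ⟩
end

section
/- Let ζ ∈ ℂ be a primitive 9th root of unity, let K = ℚ(ζ), and let F = ℚ(ζ³) (the imaginary quadratic subfield of K generated by the primitive cube root of unity ζ³). If α ∈ K satisfies ℚ(α) = K and α⁹ ∈ F, then α³ ∈ F. (This shows that a simple ordinary abelian threefold that splits over a degree 9 extension already splits over a degree 3 extension, ruling out the case m = 9 in the splitting theorem.) -/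
open Polynomial in
/-- A rational polynomial vanishing at a primitive `n`-th root of unity vanishes at all of them. -/
theorem IsPrimitiveRoot.aeval_pow_eq_zero {n : ℕ} (hn : 0 < n) {ζ : ℂ} (hζ : IsPrimitiveRoot ζ n)
    {k : ℕ} (hk : k.Coprime n) {P : ℚ[X]} (hP : aeval ζ P = 0) : aeval (ζ ^ k) P = 0 := by
  have hd : cyclotomic n ℚ ∣ P := by
    rw [cyclotomic_eq_minpoly_rat hζ hn]
    exact minpoly.dvd ℚ ζ hP
  refine aeval_eq_zero_of_dvd_aeval_eq_zero hd ?_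
  have h : NeZero (n : ℂ) := ⟨by exact_mod_cast hn.ne'⟩
  have hroot := isRoot_cyclotomic_iff.2 (hζ.pow_of_coprime k hk)
  rwa [← map_cyclotomic n (algebraMap ℚ ℂ), IsRoot.def, eval_map_algebraMap] at hroot

open Polynomial in
/-- The sum of the conjugates of `P(ζ)` over `ℚ(ζ³)` lies in `ℚ(ζ³)`. -/
theorem IsPrimitiveRoot.aeval_conjugates_sum_mem {ζ : ℂ} (hζ : IsPrimitiveRoot ζ 9) (P : ℚ[X]) :
    aeval ζ P + aeval (ζ ^ 4) P + aeval (ζ ^ 7) P ∈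
      IntermediateField.adjoin ℚ ({ζ ^ 3} : Set ℂ) := by
  have hω : ζ ^ 3 ∈ IntermediateField.adjoin ℚ ({ζ ^ 3} : Set ℂ) :=
    IntermediateField.mem_adjoin_simple_self ℚ _
  have h3 : IsPrimitiveRoot (ζ ^ 3) 3 := hζ.pow (by norm_num) (by norm_num)
  have hsum : 1 + ζ ^ 3 + ζ ^ 6 = 0 := by
    have := h3.geom_sum_eq_zero (by norm_num)
    simp only [Finset.sum_range_succ, Finset.sum_range_zero] at this
    linear_combination this
  have h9 : ζ ^ 9 = 1 := hζ.pow_eq_one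
  induction P using Polynomial.induction_on' with
  | add p q hp hq =>
    convert add_mem hp hq using 1
    simp only [map_add]
    ring
  | monomial n a =>
    simp only [aeval_monomial]
    rw [← mul_add, ← mul_add]
    refine mul_mem (IntermediateField.algebraMap_mem _ a) ?_
    have e4 (m : ℕ) : (ζ ^ 4) ^ (3 * m) = (ζ ^ 3) ^ m := by
      rw [pow_mul, show (ζ ^ 4) ^ 3 = ζ ^ 3 by linear_combination ζ ^ 3 * h9]
    have e7 (m : ℕ) : (ζ ^ 7) ^ (3 * m) = (ζ ^ 3) ^ m := by
      rw [pow_mul, show (ζ ^ 7) ^ 3 = ζ ^ 3 by linear_combination (ζ ^ 12 + ζ ^ 3) * h9]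
    obtain ⟨m, rfl | rfl | rfl⟩ : ∃ m, n = 3 * m ∨ n = 3 * m + 1 ∨ n = 3 * m + 2 :=
      ⟨n / 3, by omega⟩
    · rw [e4, e7, pow_mul]
      exact add_mem (add_mem (pow_mem hω m) (pow_mem hω m)) (pow_mem hω m)
    · suffices h : ζ ^ (3 * m + 1) + (ζ ^ 4) ^ (3 * m + 1) + (ζ ^ 7) ^ (3 * m + 1) = 0 from
        h ▸ zero_mem (IntermediateField.adjoin ℚ ({ζ ^ 3} : Set ℂ))
      rw [pow_add, pow_add, pow_add, e4, e7, pow_mul]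
      linear_combination (ζ ^ 3) ^ m * ζ * hsum
    · suffices h : ζ ^ (3 * m + 2) + (ζ ^ 4) ^ (3 * m + 2) + (ζ ^ 7) ^ (3 * m + 2) = 0 from
        h ▸ zero_mem (IntermediateField.adjoin ℚ ({ζ ^ 3} : Set ℂ))
      rw [pow_add, pow_add, pow_add, e4, e7, pow_mul]
      linear_combination (ζ ^ 3) ^ m * ζ ^ 2 * hsum + (ζ ^ 3) ^ m * ζ ^ 5 * h9

open Polynomial in
/-- **Ruling out the degree 9 splitting (Howe's argument).**
Let `ζ` be a primitive 9th root of unity, `K = ℚ(ζ)`, `F = ℚ(ζ³)`.  If `α ∈ K` generates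
`K` over `ℚ` and `α⁹ ∈ F`, then already `α³ ∈ F`. -/
theorem ninth_power_descends_to_cube (ζ : ℂ) (hζ : IsPrimitiveRoot ζ 9) (α : ℂ)
    (hK : IntermediateField.adjoin ℚ ({α} : Set ℂ) =
      IntermediateField.adjoin ℚ ({ζ} : Set ℂ))
    (h9 : α ^ 9 ∈ IntermediateField.adjoin ℚ ({ζ ^ 3} : Set ℂ)) :
    α ^ 3 ∈ IntermediateField.adjoin ℚ ({ζ ^ 3} : Set ℂ) := by
  have exists_aeval : ∀ x y : ℂ, x ^ 9 = 1 →
      y ∈ IntermediateField.adjoin ℚ ({x} : Set ℂ) → ∃ P : ℚ[X], aeval x P = y := by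
    intro x y hx hy
    have hint : IsIntegral ℚ x :=
      IsIntegral.of_pow (n := 9) (by norm_num) (hx ▸ isIntegral_one)
    have := IntermediateField.mem_toSubalgebra _ y |>.2 hy
    rw [IntermediateField.adjoin_simple_toSubalgebra_of_isAlgebraic hint.isAlgebraic,
      Algebra.adjoin_singleton_eq_range_aeval] at this
    exact this
  have hζ9 : ζ ^ 9 = 1 := hζ.pow_eq_one
  have hα : α ∈ IntermediateField.adjoin ℚ ({ζ} : Set ℂ) :=
    hK ▸ IntermediateField.mem_adjoin_simple_self ℚ α
  obtain ⟨p, hp⟩ := exists_aeval ζ α hζ9 hα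
  obtain ⟨q, hq⟩ := exists_aeval (ζ ^ 3) (α ^ 9)
    (by linear_combination (ζ ^ 18 + ζ ^ 9 + 1) * hζ9) h9
  by_cases h0 : α = 0
  · simp [h0]
  have conj : ∀ {P : ℚ[X]}, aeval ζ P = 0 → aeval (ζ ^ 4) P = 0 ∧ aeval (ζ ^ 7) P = 0 :=
    fun hP => ⟨hζ.aeval_pow_eq_zero (by norm_num) (by norm_num) hP,
      hζ.aeval_pow_eq_zero (by norm_num) (by norm_num) hP⟩
  have hpow : aeval (ζ ^ 4) p ^ 9 = α ^ 9 := by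
    have := (conj (P := p ^ 9 - expand ℚ 3 q) (by simp [hp, hq, expand_aeval])).1
    rw [map_sub, map_pow, expand_aeval,
      show (ζ ^ 4) ^ 3 = ζ ^ 3 by linear_combination ζ ^ 3 * hζ9, hq] at this
    exact sub_eq_zero.1 this
  obtain ⟨k, -, hk⟩ := hζ.eq_pow_of_pow_eq_one (ξ := aeval (ζ ^ 4) p / α)
    (by rw [div_pow, hpow, div_self (pow_ne_zero 9 h0)])
  have hσ : aeval (ζ ^ 4) p = ζ ^ k * α := by rw [hk, div_mul_cancel₀ _ h0]
  obtain ⟨hσ4, hσ7⟩ := conj (P := expand ℚ 4 p - X ^ k * p) (by simp [hp, hσ, expand_aeval])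
  rw [map_sub, map_mul, map_pow, aeval_X, expand_aeval, sub_eq_zero] at hσ4 hσ7
  rw [show (ζ ^ 4) ^ 4 = ζ ^ 7 by linear_combination ζ ^ 7 * hζ9, hσ] at hσ4
  rw [show (ζ ^ 7) ^ 4 = ζ by linear_combination (ζ ^ 19 + ζ ^ 10 + ζ) * hζ9, hp, hσ4] at hσ7
  have hnorm : ζ ^ (12 * k) = 1 := by
    apply mul_right_cancel₀ h0
    rw [one_mul]
    nth_rewrite 2 [hσ7]
    ring
  have hdvd : 9 ∣ 12 * k := (hζ.pow_eq_one_iff_dvd _).1 hnorm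
  obtain ⟨m, rfl⟩ : 3 ∣ k := by omega
  have hcube : (ζ ^ (3 * m)) ^ 3 = 1 := by
    rw [← pow_mul, show 3 * m * 3 = 9 * m by ring, pow_mul, hζ9, one_pow]
  have hcube4 : ((ζ ^ 4) ^ (3 * m)) ^ 3 = 1 := by
    rw [← pow_mul, ← pow_mul, show 4 * (3 * m * 3) = 9 * (4 * m) by ring, pow_mul, hζ9, one_pow]
  have htrace := hζ.aeval_conjugates_sum_mem (p ^ 3)
  rw [map_pow, map_pow, map_pow, hp, hσ4, hσ, mul_pow, mul_pow, mul_pow, hcube, hcube4] at htrace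
  have hthird := mul_mem (IntermediateField.algebraMap_mem
    (IntermediateField.adjoin ℚ ({ζ ^ 3} : Set ℂ)) (1 / 3 : ℚ)) htrace
  convert hthird using 1
  simp only [map_div₀, map_one, map_ofNat]
  ring
end

section
/- Let ζ = e^{4πi/5} (a primitive 5th root of unity) and let (a/5) denote the Legendre symbol modulo 5. Then in ℂ[X] one has the polynomial identity ∏_{a=1}^{4} (X − (a/5)·ζ^a) = X⁴ + √5·X³ + 3X² + √5·X + 1. (This is the normalized Frobenius polynomial Ψ_{5,1} of a simple supersingular abelian surface over F_q with q an odd power of 5.) -/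
open Polynomial

instance : Fact (Nat.Prime 5) := ⟨by norm_num⟩

/-- For `ζ = e^{4πi/5}`, the real period `ζ + ζ⁴` equals `2 cos (4π/5) = -(1 + √5) / 2`. -/
theorem exp_four_pi_div_five_add_pow_four :
    Complex.exp (4 * Real.pi * Complex.I / 5) + Complex.exp (4 * Real.pi * Complex.I / 5) ^ 4 =
      -(1 + ((Real.sqrt 5 : ℝ) : ℂ)) / 2 := by
  have hinv : Complex.exp (4 * Real.pi * Complex.I / 5) ^ 4 =
      Complex.exp (-(4 * Real.pi / 5 : ℂ) * Complex.I) := by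
    rw [← Complex.exp_nat_mul, Complex.exp_eq_exp_iff_exists_int]
    exact ⟨2, by push_cast; ring⟩
  have hcos : Real.cos (4 * Real.pi / 5) = -((1 + Real.sqrt 5) / 4) := by
    rw [← Real.cos_pi_div_five, ← Real.cos_pi_sub]
    congr 1
    ring
  have hcosC : Complex.cos (4 * Real.pi / 5) = -((1 + ((Real.sqrt 5 : ℝ) : ℂ)) / 4) := by
    exact_mod_cast congrArg (fun x : ℝ => (x : ℂ)) hcos
  rw [hinv, show (4 * Real.pi * Complex.I / 5 : ℂ) = (4 * Real.pi / 5 : ℂ) * Complex.I by ring,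
    ← Complex.two_cos, hcosC]
  ring

/-- **The normalized Frobenius polynomial `Ψ_{5,1}`.**
With `ζ = e^{4πi/5}` and `(a/5)` the Legendre symbol,
`∏_{a=1}^{4} (X - (a/5) ζ^a) = X⁴ + √5 X³ + 3X² + √5 X + 1` in `ℂ[X]`. -/
theorem psi_five_one (ζ : ℂ) (hζ : ζ = Complex.exp (4 * Real.pi * Complex.I / 5)) :
    ∏ a ∈ Finset.Icc 1 4,
        (X - C ((legendreSym 5 (a : ℤ) : ℂ) * ζ ^ a)) =
      X ^ 4 + C ((Real.sqrt 5 : ℝ) : ℂ) * X ^ 3 + C 3 * X ^ 2 +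
        C ((Real.sqrt 5 : ℝ) : ℂ) * X + 1 := by
  have h5 : ζ ^ 5 = 1 := by
    rw [hζ, ← Complex.exp_nat_mul, Complex.exp_eq_one_iff]
    exact ⟨2, by push_cast; ring⟩
  have hs : ζ + ζ ^ 4 = -(1 + ((Real.sqrt 5 : ℝ) : ℂ)) / 2 := by
    rw [hζ]
    exact exp_four_pi_div_five_add_pow_four
  have hsqrt : ((Real.sqrt 5 : ℝ) : ℂ) ^ 2 = 5 := by
    exact_mod_cast congrArg (fun x : ℝ => (x : ℂ)) (Real.sq_sqrt (show (0 : ℝ) ≤ 5 by norm_num))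
  generalize ((Real.sqrt 5 : ℝ) : ℂ) = r at *
  have ht : ζ ^ 2 + ζ ^ 3 = (r - 1) / 2 := by
    linear_combination (ζ + ζ ^ 4 - (1 + r) / 2) * hs - (2 + ζ ^ 3) * h5 + hsqrt / 4
  have l1 : legendreSym 5 1 = 1 := by decide
  have l2 : legendreSym 5 2 = -1 := by decide
  have l3 : legendreSym 5 3 = -1 := by decide
  have l4 : legendreSym 5 4 = 1 := by decide
  have hprod : ∏ a ∈ Finset.Icc 1 4, (X - C ((legendreSym 5 (a : ℤ) : ℂ) * ζ ^ a)) =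
      (X - C ζ) * (X + C ζ ^ 2) * (X + C ζ ^ 3) * (X - C ζ ^ 4) := by
    have hIcc : Finset.Icc (1 : ℤ) 4 = {1, 2, 3, 4} := by decide
    have z2 : ζ ^ (2 : ℤ) = ζ ^ 2 := zpow_ofNat ζ 2
    have z3 : ζ ^ (3 : ℤ) = ζ ^ 3 := zpow_ofNat ζ 3
    have z4 : ζ ^ (4 : ℤ) = ζ ^ 4 := zpow_ofNat ζ 4
    simp [hIcc, l1, l2, l3, l4, z2, z3, z4, mul_assoc]
  have hone : (X - C ζ) * (X - C ζ ^ 4) = X ^ 2 + C ((1 + r) / 2) * X + 1 := by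
    have h1 := congrArg C hs
    have h2 := congrArg C h5
    rw [neg_div] at h1
    simp only [map_add, map_neg, map_pow, map_one] at h1 h2
    linear_combination h2 - X * h1
  have htwo : (X + C ζ ^ 2) * (X + C ζ ^ 3) = X ^ 2 + C ((r - 1) / 2) * X + 1 := by
    have h1 := congrArg C ht
    have h2 := congrArg C h5
    simp only [map_add, map_pow, map_one] at h1 h2
    linear_combination h2 + X * h1
  have hsum : C ((1 + r) / 2) + C ((r - 1) / 2) = C r := by
    rw [← C_add]
    congr 1
    ring
  have hmul : C ((1 + r) / 2) * C ((r - 1) / 2) = (1 : ℂ[X]) := by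
    rw [← C_mul, ← C_1]
    congr 1
    linear_combination hsqrt / 4
  have hthree : (C 3 : ℂ[X]) = 3 := rfl
  rw [hprod, hthree]
  linear_combination (X + C ζ ^ 2) * (X + C ζ ^ 3) * hone +
    (X ^ 2 + C ((1 + r) / 2) * X + 1) * htwo + (X ^ 3 + X) * hsum + X ^ 2 * hmul
end

section
/- In ℝ[X] one has the polynomial identity (X⁶ + √7·X⁵ + 3X⁴ + √7·X³ + 3X² + √7·X + 1)·(X⁶ − √7·X⁵ + 3X⁴ − √7·X³ + 3X² − √7·X + 1) = X¹² − X¹⁰ + X⁸ − X⁶ + X⁴ − X² + 1, and the right-hand side is the 28th cyclotomic polynomial Φ₂₈(X). Consequently every root of h_{7,1}(X) = X⁶ + √7·X⁵ + 3X⁴ + √7·X³ + 3X² + √7·X + 1 is a primitive 28th root of unity. (This computes the Serre–Frobenius group C₂₈ of simple supersingular abelian threefolds of type Z-3 with p = 7.) -/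
open Polynomial

/-- The 28th cyclotomic polynomial, written out. -/
theorem cyclotomic_twenty_eight (R : Type*) [CommRing R] [IsDomain R] :
    cyclotomic 28 R = X ^ 12 - X ^ 10 + X ^ 8 - X ^ 6 + X ^ 4 - X ^ 2 + 1 := by
  have h4 : cyclotomic 4 R = X ^ 2 + 1 := by
    have h := cyclotomic_expand_eq_cyclotomic Nat.prime_two (dvd_refl 2) R
    simpa using h.symm
  have h28 := cyclotomic_expand_eq_cyclotomic_mul Nat.prime_seven
    (show ¬ 7 ∣ 4 by norm_num) R
  have hne : (X ^ 2 + 1 : R[X]) ≠ 0 := h4 ▸ cyclotomic_ne_zero 4 R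
  rw [h4] at h28
  simp only [map_add, map_pow, map_one, expand_X] at h28
  apply mul_right_cancel₀ hne
  rw [← h28]
  ring

/-- **The polynomial `h_{7,1}` and the 28th cyclotomic polynomial.**
In `ℝ[X]`, `h_{7,1}(X)·h_{7,1}(-X) = X¹² - X¹⁰ + X⁸ - X⁶ + X⁴ - X² + 1 = Φ₂₈(X)`, and
consequently every complex root of `h_{7,1}` is a primitive 28th root of unity. -/
theorem h_seven_one_cyclotomic :
    ((X ^ 6 + C (Real.sqrt 7) * X ^ 5 + 3 * X ^ 4 + C (Real.sqrt 7) * X ^ 3 +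
          3 * X ^ 2 + C (Real.sqrt 7) * X + 1) *
        (X ^ 6 - C (Real.sqrt 7) * X ^ 5 + 3 * X ^ 4 - C (Real.sqrt 7) * X ^ 3 +
          3 * X ^ 2 - C (Real.sqrt 7) * X + 1) =
      (X ^ 12 - X ^ 10 + X ^ 8 - X ^ 6 + X ^ 4 - X ^ 2 + 1 : ℝ[X])) ∧
    ((X ^ 12 - X ^ 10 + X ^ 8 - X ^ 6 + X ^ 4 - X ^ 2 + 1 : ℝ[X]) =
      Polynomial.cyclotomic 28 ℝ) ∧
    (∀ z : ℂ,
      Polynomial.aeval z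
          (X ^ 6 + C (Real.sqrt 7) * X ^ 5 + 3 * X ^ 4 + C (Real.sqrt 7) * X ^ 3 +
            3 * X ^ 2 + C (Real.sqrt 7) * X + 1 : ℝ[X]) = 0 →
        IsPrimitiveRoot z 28) := by
  have hfactor :
      ((X ^ 6 + C (Real.sqrt 7) * X ^ 5 + 3 * X ^ 4 + C (Real.sqrt 7) * X ^ 3 +
          3 * X ^ 2 + C (Real.sqrt 7) * X + 1) *
        (X ^ 6 - C (Real.sqrt 7) * X ^ 5 + 3 * X ^ 4 - C (Real.sqrt 7) * X ^ 3 +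
          3 * X ^ 2 - C (Real.sqrt 7) * X + 1) =
      (X ^ 12 - X ^ 10 + X ^ 8 - X ^ 6 + X ^ 4 - X ^ 2 + 1 : ℝ[X])) := by
    have hs : (C (Real.sqrt 7) ^ 2 : ℝ[X]) = 7 := by
      rw [← C_pow, Real.sq_sqrt (by norm_num)]
      rfl
    linear_combination (-(X ^ 5 + X ^ 3 + X) ^ 2 : ℝ[X]) * hs
  refine ⟨hfactor, (cyclotomic_twenty_eight ℝ).symm, fun z hz => ?_⟩
  rw [← isRoot_cyclotomic_iff_charZero (by norm_num), IsRoot.def,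
    ← map_cyclotomic 28 (algebraMap ℝ ℂ), eval_map_algebraMap, cyclotomic_twenty_eight,
    ← hfactor, map_mul, hz, zero_mul]
end

section
/- In ℝ[X] one has the polynomial identity (X⁶ + √3·X³ + 1)·(X⁶ − √3·X³ + 1) = X¹² − X⁶ + 1, and the right-hand side is the 36th cyclotomic polynomial Φ₃₆(X). Consequently every root of h_{3,3}(X) = X⁶ + √3·X³ + 1 is a primitive 36th root of unity. (This computes the Serre–Frobenius group C₃₆ of simple supersingular abelian threefolds of type Z-3 with p = 3.) -/
open Polynomial

theorem Polynomial.cyclotomic_six_eq (R : Type*) [CommRing R] :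
    cyclotomic 6 R = X ^ 2 - X + 1 := by
  have h := cyclotomic_expand_eq_cyclotomic_mul Nat.prime_three (n := 2) (by norm_num) R
  simp only [cyclotomic_two, map_add, expand_X, map_one, Nat.reduceMul] at h
  refine (monic_X_add_C (1 : R)).isRegular.right ?_
  simp only [map_one]
  rw [← h]
  ring

theorem Polynomial.cyclotomic_thirty_six_eq (R : Type*) [CommRing R] :
    cyclotomic 36 R = X ^ 12 - X ^ 6 + 1 := by
  rw [show 36 = 6 * 2 * 3 by norm_num,
    ← cyclotomic_expand_eq_cyclotomic Nat.prime_three (by norm_num),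
    ← cyclotomic_expand_eq_cyclotomic Nat.prime_two (by norm_num), cyclotomic_six_eq]
  simp only [map_add, map_sub, map_pow, expand_X, map_one]
  ring

theorem X_pow_six_add_sqrt_three_mul_sub :
    (X ^ 6 + C (Real.sqrt 3) * X ^ 3 + 1) * (X ^ 6 - C (Real.sqrt 3) * X ^ 3 + 1) =
      (X ^ 12 - X ^ 6 + 1 : ℝ[X]) := by
  have h : C (Real.sqrt 3) ^ 2 = (3 : ℝ[X]) := by
    rw [← C_pow, Real.sq_sqrt (by norm_num)]
    rfl
  linear_combination (-X ^ 6) * h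

/-- **The polynomial `h_{3,3}` and the 36th cyclotomic polynomial.**
In `ℝ[X]`, `(X⁶ + √3 X³ + 1)(X⁶ - √3 X³ + 1) = X¹² - X⁶ + 1 = Φ₃₆(X)`, and consequently
every complex root of `h_{3,3}(X) = X⁶ + √3 X³ + 1` is a primitive 36th root of unity. -/
theorem h_three_three_cyclotomic :
    ((X ^ 6 + C (Real.sqrt 3) * X ^ 3 + 1) * (X ^ 6 - C (Real.sqrt 3) * X ^ 3 + 1) =
      (X ^ 12 - X ^ 6 + 1 : ℝ[X])) ∧
    ((X ^ 12 - X ^ 6 + 1 : ℝ[X]) = Polynomial.cyclotomic 36 ℝ) ∧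
    (∀ z : ℂ,
      Polynomial.aeval z (X ^ 6 + C (Real.sqrt 3) * X ^ 3 + 1 : ℝ[X]) = 0 →
        IsPrimitiveRoot z 36) := by
  refine ⟨X_pow_six_add_sqrt_three_mul_sub, (cyclotomic_thirty_six_eq ℝ).symm, fun z hz => ?_⟩
  rw [← isRoot_cyclotomic_iff_charZero (by norm_num), IsRoot.def,
    ← map_cyclotomic 36 (algebraMap ℝ ℂ),
    eval_map_algebraMap, cyclotomic_thirty_six_eq, ← X_pow_six_add_sqrt_three_mul_sub, map_mul,
    hz, zero_mul]
end
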